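/- Let (a,b) ∈ ℝ² be a Diophantine vector. Then for Lebesgue-almost every β ∈ ℝ, setting α = aβ + b, one has liminf_{n → ∞} n (log n)² ⟨nα⟩ ⟨nβ⟩ = 0. -/

import Mathlib

/-!
Gallagher-type theorem on Diophantine planar lines (Chow–Yang, Theorem 1.4):
for a Diophantine vector `(a,b)`, almost every point `(α, β)` on the line
`α = aβ + b` satisfies `liminf_{n → ∞} n (log n)² ⟨nα⟩ ⟨nβ⟩ = 0`.
The conclusion `liminf = 0` is spelled out with explicit quantifiers
(the sequence is nonnegative, so this is equivalent).
-/

open MeasureTheory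

noncomputable section

/-- Distance from a real number to the nearest integer, `⟨x⟩`. -/
def distNearestInt (x : ℝ) : ℝ := |x - round x|

/-- `(a, b) ∈ ℝ²` is Diophantine:
`inf_{q ∈ ℕ} q^{1/2+κ} max(⟨qa⟩, ⟨qb⟩) > 0` for some `κ > 0`. -/
def IsDiophantine (a b : ℝ) : Prop :=
  ∃ κ : ℝ, 0 < κ ∧ ∃ δ : ℝ, 0 < δ ∧ ∀ q : ℕ, 0 < q →
    δ ≤ (q : ℝ) ^ ((1 : ℝ) / 2 + κ) *
      max (distNearestInt (q * a)) (distNearestInt (q * b))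

lemma dni_nonneg (x : ℝ) : 0 ≤ distNearestInt x := abs_nonneg _

lemma dni_le (x : ℝ) (n : ℤ) : distNearestInt x ≤ |x - n| := round_le x n

lemma dni_le_half (x : ℝ) : distNearestInt x ≤ 1 / 2 := abs_sub_round x

lemma dni_add_le (x y : ℝ) : distNearestInt (x + y) ≤ distNearestInt x + |y| := by
  refine (dni_le (x + y) (round x)).trans ?_
  have : x + y - round x = (x - round x) + y := by ring
  rw [this]; exact abs_add_le _ _

lemma dni_sub_le (x y : ℝ) : distNearestInt (x - y) ≤ distNearestInt x + distNearestInt y := by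
  refine (dni_le (x - y) (round x - round y)).trans ?_
  have : x - y - ((round x - round y : ℤ) : ℝ) = (x - round x) - (y - round y) := by
    push_cast; ring
  rw [this]; exact abs_sub _ _

lemma dni_nat_mul_le (q : ℕ) (x : ℝ) : distNearestInt (q * x) ≤ q * distNearestInt x := by
  refine (dni_le (q * x) (q * round x)).trans ?_
  have : (q : ℝ) * x - ((q * round x : ℤ) : ℝ) = q * (x - round x) := by
    push_cast; ring
  rw [this, abs_mul, Nat.abs_cast]; rfl

lemma dni_int_add (x : ℝ) (n : ℤ) : distNearestInt (x + n) = distNearestInt x := by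
  unfold distNearestInt; rw [round_add_intCast]; push_cast; congr 1; ring

lemma dni_neg_le (x : ℝ) : distNearestInt (-x) ≤ distNearestInt x := by
  refine (dni_le (-x) (- round x)).trans ?_
  rw [distNearestInt, ← abs_neg]; push_cast; apply le_of_eq; congr 1; ring

lemma dni_neg (x : ℝ) : distNearestInt (-x) = distNearestInt x :=
  le_antisymm (dni_neg_le x) (by simpa using dni_neg_le (-x))

lemma dni_int_mul (k : ℤ) (x : ℝ) : distNearestInt (k * x) = distNearestInt (k.natAbs * x) := by
  rcases Int.natAbs_eq k with h | h
  · conv_lhs => rw [h]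
    simp
  · conv_lhs => rw [h]
    simp only [Int.cast_neg, Int.cast_natCast, neg_mul, dni_neg]

def ef (x : ℝ) : ℂ := Complex.exp ((2 * Real.pi * x : ℝ) * Complex.I)

lemma ef_add (x y : ℝ) : ef (x + y) = ef x * ef y := by
  unfold ef; rw [← Complex.exp_add]; congr 1; push_cast; ring

lemma ef_zero : ef 0 = 1 := by simp [ef]

lemma ef_norm (x : ℝ) : ‖ef x‖ = 1 := by
  unfold ef; exact Complex.norm_exp_ofReal_mul_I _

lemma ef_neg (x : ℝ) : ef (-x) = (starRingEnd ℂ) (ef x) := by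
  unfold ef; rw [← Complex.exp_conj]; congr 1
  rw [map_mul, Complex.conj_I, Complex.conj_ofReal]; push_cast; ring

lemma ef_eq (x : ℝ) : ef x = Real.cos (2 * Real.pi * x) + Real.sin (2 * Real.pi * x) * Complex.I := by
  unfold ef; rw [Complex.exp_mul_I]; simp

lemma ef_add_neg (x : ℝ) : ef x + ef (-x) = ((2 * Real.cos (2 * Real.pi * x) : ℝ) : ℂ) := by
  rw [ef_eq, ef_eq]
  have h : 2 * Real.pi * -x = - (2 * Real.pi * x) := by ring
  rw [h, Real.cos_neg, Real.sin_neg]; push_cast; ring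

lemma one_sub_cos_ge (x : ℝ) : 8 * distNearestInt x ^ 2 ≤ 1 - Real.cos (2 * Real.pi * x) := by
  set y := x - round x with hy
  have h1 : Real.cos (2 * Real.pi * x) = Real.cos (2 * Real.pi * y) := by
    have : 2 * Real.pi * x = 2 * Real.pi * y + (round x : ℤ) * (2 * Real.pi) := by rw [hy]; ring
    rw [this, Real.cos_add_int_mul_two_pi]
  have hd : distNearestInt x = |y| := rfl
  have hy2 : |y| ≤ 1 / 2 := abs_sub_round x
  have h2 : Real.cos (2 * Real.pi * y) = 1 - 2 * Real.sin (Real.pi * |y|) ^ 2 := by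
    have : Real.cos (2 * Real.pi * y) = Real.cos (2 * (Real.pi * |y|)) := by
      rw [← Real.cos_abs]; congr 1
      rw [abs_mul, abs_of_pos (by positivity)]; ring
    rw [this, Real.cos_two_mul, Real.cos_sq']; ring
  have h3 : 2 / Real.pi * (Real.pi * |y|) ≤ Real.sin (Real.pi * |y|) := by
    apply Real.mul_le_sin (by positivity)
    nlinarith [Real.pi_pos]
  have h4 : 2 / Real.pi * (Real.pi * |y|) = 2 * |y| := by field_simp
  rw [h4] at h3
  rw [h1, h2, hd]
  nlinarith [abs_nonneg y]

lemma norm_ef_sub_one_ge (x : ℝ) : 4 * distNearestInt x ≤ ‖ef x - 1‖ := by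
  have h := one_sub_cos_ge x
  have h2 : ‖ef x - 1‖ ^ 2 = 2 * (1 - Real.cos (2 * Real.pi * x)) := by
    have h3 := Real.sin_sq_add_cos_sq (2 * Real.pi * x)
    rw [← Complex.normSq_eq_norm_sq, ef_eq, Complex.normSq_apply]
    generalize Real.cos (2 * Real.pi * x) = c at *
    generalize Real.sin (2 * Real.pi * x) = s at *
    simp
    nlinarith
  have := dni_nonneg x
  apply le_of_sq_le_sq _ (norm_nonneg _)
  nlinarith

def tent (m : ℕ) (k : ℤ) : ℝ := ((max 0 ((m : ℤ) - |k|) : ℤ) : ℝ)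

lemma tent_nonneg (m : ℕ) (k : ℤ) : 0 ≤ tent m k := by
  unfold tent; exact_mod_cast le_max_left _ _

lemma tent_le (m : ℕ) (k : ℤ) : tent m k ≤ m := by
  unfold tent
  have : max 0 ((m : ℤ) - |k|) ≤ m := by
    have := abs_nonneg k; omega
  exact_mod_cast this

lemma tent_zero_of (m : ℕ) (k : ℤ) (h : (m : ℤ) ≤ |k|) : tent m k = 0 := by
  unfold tent
  have : max 0 ((m : ℤ) - |k|) = 0 := by omega
  rw [this]; simp

def tentP (m : ℕ) (x : ℝ) : ℂ := ∑ k ∈ Finset.Icc (-(m : ℤ)) m, (tent m k : ℂ) * ef (k * x)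

lemma tent_shift (m : ℕ) (x : ℝ) (i : ℤ) (hi : |i| ≤ m) :
    ∑ k ∈ Finset.Icc (-(2 * m : ℤ)) (2 * m), (tent m (k - i) : ℂ) * ef (k * x)
      = ef (i * x) * tentP m x := by
  unfold tentP
  rw [Finset.mul_sum]
  have hi' := abs_le.mp hi
  symm
  have h1 : ∑ k ∈ Finset.Icc (-(m : ℤ)) m, ef (i * x) * ((tent m k : ℂ) * ef (k * x))
      = ∑ k ∈ Finset.Icc (-(m : ℤ) + i) (m + i), (tent m (k - i) : ℂ) * ef (k * x) := by
    refine Finset.sum_nbij' (fun k => k + i) (fun k => k - i) ?_ ?_ ?_ ?_ ?_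
    · intro k hk; simp only [Finset.mem_Icc] at hk ⊢; omega
    · intro k hk; simp only [Finset.mem_Icc] at hk ⊢; omega
    · intro k _; ring
    · intro k _; ring
    · intro k _
      have : ((k + i : ℤ) : ℝ) * x = i * x + k * x := by push_cast; ring
      rw [this, ef_add]; simp; ring
  rw [h1]
  apply Finset.sum_subset
  · intro k hk; simp only [Finset.mem_Icc] at hk ⊢; omega
  · intro k _ hk2
    rw [tent_zero_of]
    · simp
    · simp only [Finset.mem_Icc] at hk2
      by_contra hc
      have := abs_lt.mp (not_le.mp hc)
      omega

lemma tent_second_diff (m : ℕ) (hm : 1 ≤ m) (k : ℤ) :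
    tent m (k - 1) + tent m (k - (-1)) - 2 * tent m (k - 0)
      = (if k = m then 1 else 0) + (if k = -(m : ℤ) then 1 else 0) - 2 * (if k = 0 then 1 else 0) := by
  unfold tent
  have key : (max 0 ((m : ℤ) - |k - 1|)) + (max 0 ((m : ℤ) - |k - (-1)|)) - 2 * (max 0 ((m : ℤ) - |k - 0|))
      = (if k = m then 1 else 0) + (if k = -(m : ℤ) then 1 else 0) - 2 * (if k = 0 then 1 else 0) := by
    rcases abs_cases (k - 1) with h1 | h1 <;> rcases abs_cases (k - (-1)) with h2 | h2 <;>
      rcases abs_cases (k - 0) with h3 | h3 <;> rw [h1.1, h2.1, h3.1] <;> split_ifs <;> omega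
  exact_mod_cast key

lemma tent_fejer (m : ℕ) (hm : 1 ≤ m) (x : ℝ) :
    (ef x + ef (-x) - 2) * tentP m x = ef (m * x) + ef (-(m * x)) - 2 := by
  have e1 := tent_shift m x 1 (by simp; exact hm)
  have e2 := tent_shift m x (-1) (by simp; exact hm)
  have e3 := tent_shift m x 0 (by simp)
  have : (ef x + ef (-x) - 2) * tentP m x =
      ∑ k ∈ Finset.Icc (-(2 * m : ℤ)) (2 * m),
        (((tent m (k - 1) + tent m (k - (-1)) - 2 * tent m (k - 0) : ℝ)) : ℂ) * ef (k * x) := by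
    have e : ∀ k : ℤ, (((tent m (k - 1) + tent m (k - (-1)) - 2 * tent m (k - 0) : ℝ)) : ℂ) * ef (k * x)
      = (tent m (k - 1) : ℂ) * ef (k * x) + (tent m (k - (-1)) : ℂ) * ef (k * x)
        - 2 * ((tent m (k - 0) : ℂ) * ef (k * x)) := by intro k; push_cast; ring
    simp_rw [e]
    rw [Finset.sum_sub_distrib, Finset.sum_add_distrib, ← Finset.mul_sum, e1, e2, e3]
    simp [ef_zero]; ring
  rw [this]
  simp_rw [tent_second_diff m hm]
  have cst : ∀ (p : Prop) [Decidable p], ((if p then (1 : ℝ) else 0 : ℝ) : ℂ) = if p then 1 else 0 := by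
    intro p _; split_ifs <;> simp
  simp_rw [Complex.ofReal_sub, Complex.ofReal_add, Complex.ofReal_mul, cst]
  simp_rw [sub_mul, add_mul, mul_assoc, ite_mul, one_mul, zero_mul]
  rw [Finset.sum_sub_distrib, Finset.sum_add_distrib, ← Finset.mul_sum]
  simp only [Finset.sum_ite_eq', Finset.mem_Icc]
  rw [if_pos (by omega), if_pos (by omega), if_pos (by omega)]
  simp [ef_zero]

lemma tentP_real (m : ℕ) (x : ℝ) : ∃ r : ℝ, tentP m x = r := by
  have : (starRingEnd ℂ) (tentP m x) = tentP m x := by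
    unfold tentP
    rw [map_sum]
    refine Finset.sum_nbij' (fun k => -k) (fun k => -k) ?_ ?_ ?_ ?_ ?_
    · intro k hk; simp only [Finset.mem_Icc] at hk ⊢; omega
    · intro k hk; simp only [Finset.mem_Icc] at hk ⊢; omega
    · intro k _; ring
    · intro k _; ring
    · intro k _
      rw [map_mul, ← ef_neg, Complex.conj_ofReal]
      have : tent m (-k) = tent m k := by simp [tent]
      rw [this]; push_cast; rw [neg_mul]
  obtain ⟨r, hr⟩ := Complex.conj_eq_iff_real.mp this
  exact ⟨r, hr⟩

lemma sum_sq_ge (m : ℕ) : (m : ℝ) ^ 3 / 3 ≤ ∑ j ∈ Finset.range (m + 1), (j : ℝ) ^ 2 := by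
  induction m with
  | zero => simp
  | succ n ih =>
    rw [Finset.sum_range_succ]; push_cast at *
    have : (0:ℝ) ≤ n := by positivity
    nlinarith

def tconv (m : ℕ) (k : ℤ) : ℝ := ∑ i ∈ Finset.Icc (-(m : ℤ)) m, tent m i * tent m (k - i)

lemma tconv_sum (m : ℕ) (x : ℝ) :
    ∑ k ∈ Finset.Icc (-(2 * m : ℤ)) (2 * m), (tconv m k : ℂ) * ef (k * x) = tentP m x ^ 2 := by
  unfold tconv
  push_cast
  simp_rw [Finset.sum_mul]
  rw [Finset.sum_comm, sq]
  rw [show tentP m x * tentP m x = (∑ k ∈ Finset.Icc (-(m : ℤ)) m, (tent m k : ℂ) * ef (k * x)) *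
    tentP m x from rfl, Finset.sum_mul]
  apply Finset.sum_congr rfl
  intro i hi
  rw [mul_assoc, ← tent_shift m x i (abs_le.mpr (by simpa using hi)), Finset.mul_sum]
  apply Finset.sum_congr rfl
  intro k _; ring

lemma tconv_zero_ge (m : ℕ) : (m : ℝ) ^ 3 / 3 ≤ tconv m 0 := by
  refine (sum_sq_ge m).trans ?_
  unfold tconv
  have h1 : ∑ j ∈ Finset.range (m + 1), (j : ℝ) ^ 2
      = ∑ i ∈ Finset.Icc (0 : ℤ) m, tent m i * tent m (0 - i) := by
    refine Finset.sum_nbij' (fun j => (m : ℤ) - j) (fun i => ((m : ℤ) - i).toNat) ?_ ?_ ?_ ?_ ?_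
    · intro k hk; simp only [Finset.mem_Icc, Finset.mem_range] at hk ⊢; omega
    · intro k hk; simp only [Finset.mem_Icc, Finset.mem_range] at hk ⊢; omega
    · intro k hk; simp only [Finset.mem_range] at hk; omega
    · intro k hk; simp only [Finset.mem_Icc] at hk; omega
    · intro k hk
      simp only [Finset.mem_range] at hk
      have e : tent m ((m : ℤ) - k) = k := by
        unfold tent
        have : max 0 ((m : ℤ) - |(m : ℤ) - k|) = k := by
          rw [abs_of_nonneg (by omega)]; omega
        rw [this]; simp
      have e2 : tent m (0 - ((m : ℤ) - k)) = k := by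
        rw [← e]; unfold tent; rw [zero_sub, abs_neg]
      rw [e, e2]; ring
  rw [h1]
  apply Finset.sum_le_sum_of_subset_of_nonneg
  · intro k hk; simp only [Finset.mem_Icc] at hk ⊢; omega
  · intro i _ _; exact mul_nonneg (tent_nonneg _ _) (tent_nonneg _ _)

lemma tconv_nonneg (m : ℕ) (k : ℤ) : 0 ≤ tconv m k :=
  Finset.sum_nonneg fun i _ => mul_nonneg (tent_nonneg _ _) (tent_nonneg _ _)

lemma tconv_le (m : ℕ) (hm : 1 ≤ m) (k : ℤ) : tconv m k ≤ 3 * (m : ℝ) ^ 3 := by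
  unfold tconv
  have h : ∑ i ∈ Finset.Icc (-(m : ℤ)) m, tent m i * tent m (k - i)
      ≤ ∑ i ∈ Finset.Icc (-(m : ℤ)) m, (m : ℝ) * m :=
    Finset.sum_le_sum fun i _ =>
      mul_le_mul (tent_le _ _) (tent_le _ _) (tent_nonneg _ _) (by positivity)
  refine h.trans ?_
  rw [Finset.sum_const, Int.card_Icc, nsmul_eq_mul]
  have e : (((m : ℤ) + 1 - -(m : ℤ)).toNat : ℝ) = 2 * m + 1 := by
    have : ((m : ℤ) + 1 - -(m : ℤ)).toNat = 2 * m + 1 := by omega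
    rw [this]; push_cast; ring
  rw [e]
  have : (1 : ℝ) ≤ m := by exact_mod_cast hm
  nlinarith [mul_pos (show (0:ℝ) < m by linarith) (show (0:ℝ) < m by linarith)]

theorem kernel_exists (m : ℕ) (hm : 1 ≤ m) : ∃ g : ℤ → ℝ, 1 / (m : ℝ) ≤ g 0 ∧
    (∀ k, |g k| ≤ 20 / m) ∧
    ∀ x : ℝ, ∃ r : ℝ, ∑ k ∈ Finset.Icc (-(2 * m : ℤ)) (2 * m), (g k : ℂ) * ef (k * x) = r ∧
      (0 < r → distNearestInt x < 1 / m) := by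
  have hm1 : (1 : ℝ) ≤ m := by exact_mod_cast hm
  have hm0 : (0 : ℝ) < m := by linarith
  refine ⟨fun k => 6 / (m : ℝ) ^ 4 * tconv m k - tent m (k - 0) / m ^ 2 +
    (tent m (k - m) + tent m (k - (-(m : ℤ)))) / (2 * m ^ 2), ?_, ?_, ?_⟩
  · have h1 := tconv_zero_ge m
    have h2 : tent m (0 - (m : ℤ)) = 0 := tent_zero_of _ _ (by simp)
    have h3 : tent m (0 - (-(m : ℤ))) = 0 := tent_zero_of _ _ (by simp)
    have h4 : tent m (0 - 0) = m := by simp [tent]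
    beta_reduce
    rw [h2, h3, h4]
    have : 6 / (m : ℝ) ^ 4 * ((m : ℝ) ^ 3 / 3) ≤ 6 / (m : ℝ) ^ 4 * tconv m 0 := by gcongr
    have e : 6 / (m : ℝ) ^ 4 * ((m : ℝ) ^ 3 / 3) = 2 / m := by field_simp; norm_num
    have e2 : (m : ℝ) / m ^ 2 = 1 / m := by field_simp
    rw [e] at this
    rw [e2, add_zero, zero_div]
    have e3 : 2 / (m : ℝ) = 1 / m + 1 / m := by ring
    linarith
  · intro k
    have a1 : |6 / (m : ℝ) ^ 4 * tconv m k| ≤ 18 / (m : ℝ) := by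
      rw [abs_of_nonneg (mul_nonneg (by positivity) (tconv_nonneg _ _))]
      calc 6 / (m : ℝ) ^ 4 * tconv m k ≤ 6 / (m : ℝ) ^ 4 * (3 * (m : ℝ) ^ 3) := by
            gcongr; exact tconv_le m hm k
        _ = 18 / (m : ℝ) := by field_simp; norm_num
    have a2 : |tent m (k - 0) / (m : ℝ) ^ 2| ≤ 1 / (m : ℝ) := by
      rw [abs_of_nonneg (div_nonneg (tent_nonneg _ _) (by positivity))]
      calc tent m (k - 0) / (m : ℝ) ^ 2 ≤ m / (m : ℝ) ^ 2 := by gcongr; exact tent_le _ _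
        _ = 1 / (m : ℝ) := by field_simp
    have a3 : |(tent m (k - m) + tent m (k - (-(m : ℤ)))) / (2 * (m : ℝ) ^ 2)| ≤ 1 / (m : ℝ) := by
      rw [abs_of_nonneg (div_nonneg (add_nonneg (tent_nonneg _ _) (tent_nonneg _ _)) (by positivity))]
      calc _ ≤ ((m : ℝ) + m) / (2 * (m : ℝ) ^ 2) := by gcongr <;> exact tent_le _ _
        _ = 1 / (m : ℝ) := by field_simp; norm_num
    have e : 20 / (m : ℝ) = 18 / m + 1 / m + 1 / m := by ring
    rw [e]
    refine (abs_add_le _ _).trans (add_le_add ((abs_sub _ _).trans (add_le_add a1 a2)) a3)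
  · intro x
    obtain ⟨P, hP⟩ := tentP_real m x
    set C := Real.cos (2 * Real.pi * x) with hC
    refine ⟨(6 / (m : ℝ) ^ 2 - 1 + C) * P ^ 2 / m ^ 2, ?_, ?_⟩
    · have s1 := tconv_sum m x
      have s2 := tent_shift m x 0 (by simp)
      have s3 := tent_shift m x m (by simp)
      have s4 := tent_shift m x (-(m : ℤ)) (by simp)
      have F := tent_fejer m hm x
      rw [ef_add_neg, ← hC] at F
      have e : ∀ k : ℤ, ((6 / (m : ℝ) ^ 4 * tconv m k - tent m (k - 0) / m ^ 2 +
          (tent m (k - m) + tent m (k - (-(m : ℤ)))) / (2 * m ^ 2) : ℝ) : ℂ) * ef (k * x)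
        = (6 / (m : ℂ) ^ 4) * ((tconv m k : ℂ) * ef (k * x))
          - (1 / (m : ℂ) ^ 2) * ((tent m (k - 0) : ℂ) * ef (k * x))
          + (1 / (2 * (m : ℂ) ^ 2)) * ((tent m (k - m) : ℂ) * ef (k * x))
          + (1 / (2 * (m : ℂ) ^ 2)) * ((tent m (k - (-(m : ℤ))) : ℂ) * ef (k * x)) := by
        intro k; push_cast; ring
      simp_rw [e]
      rw [Finset.sum_add_distrib, Finset.sum_add_distrib, Finset.sum_sub_distrib,
        ← Finset.mul_sum, ← Finset.mul_sum, ← Finset.mul_sum, ← Finset.mul_sum, s1, s2, s3, s4]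
      have hmc : (m : ℂ) ≠ 0 := by exact_mod_cast hm0.ne'
      push_cast
      rw [zero_mul, ef_zero, neg_mul]
      have F2 : ef (m * x) + ef (-(m * x)) = (((2 * C : ℝ) : ℂ) - 2) * tentP m x + 2 := by
        linear_combination -F
      rw [hP] at F2 ⊢
      push_cast at F2
      field_simp
      linear_combination ((m:ℂ)^2 * P) * F2
    · intro hr
      have h8 := one_sub_cos_ge x
      rw [← hC] at h8
      have hA : 0 < 6 / (m : ℝ) ^ 2 - 1 + C := by
        by_contra hc
        push Not at hc
        have : (6 / (m : ℝ) ^ 2 - 1 + C) * P ^ 2 / m ^ 2 ≤ 0 :=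
          div_nonpos_of_nonpos_of_nonneg (mul_nonpos_of_nonpos_of_nonneg hc (sq_nonneg _)) (by positivity)
        linarith
      have : distNearestInt x ^ 2 < (1 / (m : ℝ)) ^ 2 := by
        have e : (1 / (m : ℝ)) ^ 2 = 1 / (m : ℝ) ^ 2 := by ring
        have e6 : 6 / (m : ℝ) ^ 2 = 6 * (1 / (m : ℝ) ^ 2) := by ring
        have : 0 < 1 / (m : ℝ) ^ 2 := by positivity
        rw [e]; nlinarith
      exact lt_of_pow_lt_pow_left₀ 2 (by positivity) this

lemma dich (a b : ℝ) (hab : IsDiophantine a b) : ∃ E0 : ℕ, ∃ δ : ℝ, 0 < δ ∧ ∀ Q : ℕ, 1 ≤ Q →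
    (∀ q : ℕ, 1 ≤ q → q ≤ Q → δ / (Q : ℝ) ^ E0 ≤ distNearestInt (q * a)) ∨
    (∀ q : ℕ, 1 ≤ q → q ≤ Q → δ / (Q : ℝ) ^ E0 ≤ distNearestInt (q * b)) := by
  obtain ⟨κ, hκ, δ, hδ, h⟩ := hab
  obtain ⟨k0, hk0⟩ := exists_nat_ge ((1 : ℝ) / 2 + κ)
  refine ⟨2 * k0 + 1, δ, hδ, fun Q hQ => ?_⟩
  by_contra hc
  push Not at hc
  obtain ⟨⟨q1, h1, h1Q, hq1⟩, q2, h2, h2Q, hq2⟩ := hc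
  have hQ1 : (1 : ℝ) ≤ Q := by exact_mod_cast hQ
  set τ := δ / (Q : ℝ) ^ (2 * k0 + 1) with hτ
  have hτ0 : 0 < τ := by positivity
  have hh := h (q1 * q2) (by positivity)
  have e1 : distNearestInt ((q1 * q2 : ℕ) * a) < Q * τ := by
    have : ((q1 * q2 : ℕ) : ℝ) * a = q2 * (q1 * a) := by push_cast; ring
    rw [this]
    refine (dni_nat_mul_le _ _).trans_lt ?_
    have : (q2 : ℝ) ≤ Q := by exact_mod_cast h2Q
    have h0 : (1 : ℝ) ≤ q2 := by exact_mod_cast h2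
    nlinarith [dni_nonneg (q1 * a)]
  have e2 : distNearestInt ((q1 * q2 : ℕ) * b) < Q * τ := by
    have : ((q1 * q2 : ℕ) : ℝ) * b = q1 * (q2 * b) := by push_cast; ring
    rw [this]
    refine (dni_nat_mul_le _ _).trans_lt ?_
    have : (q1 : ℝ) ≤ Q := by exact_mod_cast h1Q
    have h0 : (1 : ℝ) ≤ q1 := by exact_mod_cast h1
    nlinarith [dni_nonneg (q2 * b)]
  have e3 := max_lt e1 e2
  have hq1' : (1 : ℝ) ≤ (q1 * q2 : ℕ) := by exact_mod_cast Nat.mul_pos h1 h2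
  have e4 : ((q1 * q2 : ℕ) : ℝ) ^ ((1 : ℝ) / 2 + κ) ≤ (Q : ℝ) ^ (2 * k0) := by
    calc ((q1 * q2 : ℕ) : ℝ) ^ ((1 : ℝ) / 2 + κ) ≤ ((q1 * q2 : ℕ) : ℝ) ^ (k0 : ℝ) :=
          Real.rpow_le_rpow_of_exponent_le hq1' hk0
      _ = ((q1 * q2 : ℕ) : ℝ) ^ k0 := Real.rpow_natCast _ _
      _ ≤ ((Q : ℝ) ^ 2) ^ k0 := by
          gcongr
          have : q1 * q2 ≤ Q ^ 2 := by rw [sq]; exact Nat.mul_le_mul h1Q h2Q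
          exact_mod_cast this
      _ = _ := by rw [← pow_mul]
  have e5 : ((q1 * q2 : ℕ) : ℝ) ^ ((1 : ℝ) / 2 + κ) *
      max (distNearestInt ((q1 * q2 : ℕ) * a)) (distNearestInt ((q1 * q2 : ℕ) * b))
      < (Q : ℝ) ^ (2 * k0) * (Q * τ) := by
    have : 0 < ((q1 * q2 : ℕ) : ℝ) ^ ((1 : ℝ) / 2 + κ) := Real.rpow_pos_of_pos (by linarith) _
    calc _ < ((q1 * q2 : ℕ) : ℝ) ^ ((1 : ℝ) / 2 + κ) * (Q * τ) := by gcongr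
      _ ≤ _ := by gcongr
  have e6 : (Q : ℝ) ^ (2 * k0) * (Q * τ) = δ := by
    rw [hτ, pow_succ]; field_simp
  linarith

@[ext] structure M2 where
  p : ℤ
  q : ℤ
  r : ℤ
  s : ℤ

def M2.phi (g : M2) (t : ℝ) : ℝ := (g.p * t + g.r) / (g.q * t + g.s)

structure IsF (c d : ℝ) (N : ℕ) (g : M2) : Prop where
  hq8 : (N : ℤ) < 8 * g.q
  hqN : g.q ≤ N
  hs1 : 1 ≤ g.s
  hsN : g.s ≤ N
  hqs : (N : ℤ) < g.q + g.s
  det : g.p * g.s - g.r * g.q = 1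
  hc : c * g.q < g.p
  hd : (g.p : ℝ) ≤ d * g.q
  hphi : ∀ t ∈ Set.Icc (1 : ℝ) 2, g.phi t ∈ Set.Icc c d

lemma IsF.q1 {c d : ℝ} {N : ℕ} {g : M2} (h : IsF c d N g) : 1 ≤ g.q := by
  have := h.hq8; omega

lemma IsF.ext_pq {c d : ℝ} {N : ℕ} {g g' : M2} (h : IsF c d N g) (h' : IsF c d N g')
    (hp : g.p = g'.p) (hq : g.q = g'.q) : g = g' := by
  obtain ⟨p, q, r, s⟩ := g
  obtain ⟨p', q', r', s'⟩ := g'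
  have hq1 := h.q1
  obtain ⟨_, a1, a2, a3, a4, a5, _, _, _⟩ := h
  obtain ⟨_, b1, b2, b3, b4, b5, _, _, _⟩ := h'
  simp only at *
  subst hp hq
  have e : p * (s - s') = q * (r - r') := by linear_combination a5 - b5
  have hcop : IsCoprime q p := ⟨-r, s, by linear_combination a5⟩
  have hdvd : q ∣ s - s' := hcop.dvd_of_dvd_mul_left ⟨_, e⟩
  have hs : s - s' = 0 := by
    apply Int.eq_zero_of_abs_lt_dvd hdvd
    rw [abs_lt]; constructor <;> omega
  rw [hs, mul_zero] at e
  have hr : r - r' = 0 := by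
    rcases mul_eq_zero.mp e.symm with h | h
    · omega
    · exact h
  have e1 : s = s' := by omega
  have e2 : r = r' := by omega
  subst e1 e2; rfl

lemma IsF.ext_qs {N : ℕ} {g g' : M2} (hN : 8 ≤ N) (h : IsF 1 2 N g) (h' : IsF 1 2 N g')
    (hq : g.q = g'.q) (hs : g.s = g'.s) : g = g' := by
  refine h.ext_pq h' ?_ hq
  obtain ⟨p, q, r, s⟩ := g
  obtain ⟨p', q', r', s'⟩ := g'
  have hq1 := h.q1
  obtain ⟨a0, a1, a2, a3, a4, a5, a6, a7, _⟩ := h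
  obtain ⟨b0, b1, b2, b3, b4, b5, b6, b7, _⟩ := h'
  simp only at *
  subst hq hs
  have e : s * (p - p') = q * (r - r') := by linear_combination a5 - b5
  have hcop : IsCoprime q s := ⟨-r, p, by linear_combination a5⟩
  have hdvd : q ∣ p - p' := hcop.dvd_of_dvd_mul_left ⟨_, e⟩
  have a6' : q < p := by rw [one_mul] at a6; exact_mod_cast a6
  have b6' : q < p' := by rw [one_mul] at b6; exact_mod_cast b6
  have a7' : p ≤ 2 * q := by exact_mod_cast a7
  have b7' : p' ≤ 2 * q := by exact_mod_cast b7
  have : p - p' = 0 := by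
    apply Int.eq_zero_of_abs_lt_dvd hdvd
    rw [abs_lt]; constructor <;> omega
  omega

lemma IsF.phi_lt {c d : ℝ} {N : ℕ} {g : M2} (h : IsF c d N g) {t : ℝ} (ht : 0 < t) :
    g.r * (g.q * t + g.s) < g.s * (g.p * t + g.r) ∧
    g.q * (g.p * t + g.r) < g.p * (g.q * t + g.s) := by
  have hd : (g.p : ℝ) * g.s - g.r * g.q = 1 := by exact_mod_cast h.det
  constructor <;> nlinarith

lemma IsF.den_pos {c d : ℝ} {N : ℕ} {g : M2} (h : IsF c d N g) {t : ℝ} (ht : 0 < t) :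
    0 < g.q * t + g.s := by
  have h1 : (1 : ℝ) ≤ g.q := by exact_mod_cast h.q1
  have h2 : (1 : ℝ) ≤ g.s := by exact_mod_cast h.hs1
  nlinarith

lemma IsF.disj_aux {c d : ℝ} {N : ℕ} {g g' : M2} (h : IsF c d N g) (h' : IsF c d N g')
    {t t' : ℝ} (ht : 0 < t) (ht' : 0 < t') (he : g.phi t = g'.phi t') :
    ¬ g.p * g'.q < g'.p * g.q := by
  intro hlt
  have D := h.den_pos ht
  have D' := h'.den_pos ht'
  obtain ⟨x1, x2⟩ := h.phi_lt ht
  obtain ⟨y1, y2⟩ := h'.phi_lt ht'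
  unfold M2.phi at he
  set n := (g.p * t + g.r : ℝ)
  set m := (g.q * t + g.s : ℝ)
  set n' := (g'.p * t' + g'.r : ℝ)
  set m' := (g'.q * t' + g'.s : ℝ)
  rw [div_eq_div_iff D.ne' D'.ne'] at he
  have hq : (0 : ℝ) < g.q := by exact_mod_cast h.q1
  have hs' : (0 : ℝ) < g'.s := by exact_mod_cast h'.hs1
  -- r'/s' < n'/m' = n/m < p/q
  have z : (g'.r : ℝ) * g.q < g.p * g'.s := by
    by_contra hc
    push Not at hc
    have i1 : g'.r * m' * (g.q * m) < g'.s * n' * (g.q * m) := by gcongr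
    have i2 : g'.s * m' * (g.q * n) < g'.s * m' * (g.p * m) := by gcongr
    have i3 : (g.p * g'.s) * (m * m') ≤ (g'.r * g.q) * (m * m') := by gcongr
    have i4 : g'.s * m' * (g.q * n) = g'.s * n' * (g.q * m) := by
      linear_combination (g'.s * g.q : ℝ) * he
    linarith
  have z' : g'.r * g.q < g.p * g'.s := by exact_mod_cast z
  have e : g.q = g'.q * (g.p * g'.s - g'.r * g.q) + g'.s * (g'.p * g.q - g.p * g'.q) := by
    linear_combination (-g.q) * h'.det
  have := h'.hqs
  have := h.hqN
  have := h'.q1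
  have := h'.hs1
  nlinarith

lemma IsF.disj {c d : ℝ} {N : ℕ} {g g' : M2} (h : IsF c d N g) (h' : IsF c d N g')
    {t t' : ℝ} (ht : 0 < t) (ht' : 0 < t') (he : g.phi t = g'.phi t') : g = g' := by
  have a1 := h.disj_aux h' ht ht' he
  have a2 := h'.disj_aux h ht' ht he.symm
  have e : g.p * g'.q = g'.p * g.q := by omega
  have hc : IsCoprime g.q g.p := ⟨-g.r, g.s, by linear_combination h.det⟩
  have hc' : IsCoprime g'.q g'.p := ⟨-g'.r, g'.s, by linear_combination h'.det⟩
  have d1 : g.q ∣ g'.q := hc.dvd_of_dvd_mul_left ⟨g'.p, by linear_combination e⟩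
  have d2 : g'.q ∣ g.q := hc'.dvd_of_dvd_mul_left ⟨g.p, by linear_combination -e⟩
  have hq : g.q = g'.q := Int.dvd_antisymm (by have := h.q1; omega) (by have := h'.q1; omega) d1 d2
  refine h.ext_pq h' ?_ hq
  rw [hq] at e
  have := h'.q1
  exact mul_right_cancel₀ (by omega) e

lemma exists_F (c d : ℝ) (N : ℕ) (p q : ℤ) (hN : 1 ≤ N) (hq8 : (N : ℤ) < 8 * q) (hqN : q ≤ N)
    (hcop : IsCoprime p q) (hc : c * q + 8 * q / (N : ℝ) ^ 2 < p) (hd : (p : ℝ) ≤ d * q) :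
    ∃ g : M2, g.p = p ∧ g.q = q ∧ IsF c d N g := by
  obtain ⟨u, v, huv⟩ := hcop
  -- u * p + v * q = 1 ; s = u mod q shifted
  have hq0 : 0 < q := by omega
  set k := ((N : ℤ) - u) / q with hk
  have k1 : q * k ≤ N - u := Int.mul_ediv_self_le hq0.ne'
  have k2 : (N : ℤ) - u < q * k + q := by
    have := Int.lt_mul_ediv_self_add (x := (N : ℤ) - u) hq0
    linarith
  have hN' : (1 : ℝ) ≤ N := by exact_mod_cast hN
  have hqr : (0 : ℝ) < q := by exact_mod_cast hq0
  have hdet : p * (u + q * k) - (p * k - v) * q = 1 := by linear_combination huv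
  have hs1 : 1 ≤ u + q * k := by linarith
  have hqs : (N : ℤ) < q + (u + q * k) := by linarith
  refine ⟨⟨p, q, p * k - v, u + q * k⟩, rfl, rfl, ⟨hq8, hqN, hs1, by simp only; linarith, hqs, hdet, ?_, hd, ?_⟩⟩
  · simp only
    have : 0 ≤ 8 * (q : ℝ) / (N : ℝ) ^ 2 := by positivity
    linarith
  · intro t ht
    set s := u + q * k
    set r := p * k - v
    have hs : (1 : ℝ) ≤ s := by exact_mod_cast hs1
    have hD : 0 < (q : ℝ) * t + s := by nlinarith [ht.1]
    have hD2 : (N : ℝ) ≤ (q : ℝ) * t + s := by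
      have : (N : ℝ) < q + s := by exact_mod_cast hqs
      nlinarith [ht.1]
    have hdet' : (p : ℝ) * s - r * q = 1 := by exact_mod_cast hdet
    have e : M2.phi ⟨p, q, r, s⟩ t = p / q - 1 / (q * (q * t + s)) := by
      simp only [M2.phi]
      rw [div_sub_div _ _ hqr.ne' (mul_pos hqr hD).ne', div_eq_div_iff hD.ne'
        (mul_pos hqr (mul_pos hqr hD)).ne']
      linear_combination (-(q : ℝ) * (q * t + s)) * hdet'
    rw [e]
    have hq8' : (N : ℝ) < 8 * q := by exact_mod_cast hq8
    have b1 : 1 / ((q : ℝ) * (q * t + s)) ≤ 8 / (N : ℝ) ^ 2 := by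
      rw [div_le_div_iff₀ (by positivity) (by positivity)]
      nlinarith
    have b0 : 0 ≤ 1 / ((q : ℝ) * (q * t + s)) := by positivity
    constructor
    · have : c + 8 / (N : ℝ) ^ 2 < p / q := by
        rw [lt_div_iff₀ hqr]
        calc _ = c * q + 8 * q / (N : ℝ) ^ 2 := by ring
          _ < p := hc
      linarith
    · have : (p : ℝ) / q ≤ d := by rw [div_le_iff₀ hqr]; exact hd
      linarith

lemma card_Icc_real_le (x y : ℝ) (h : x ≤ y) : ((Finset.Icc ⌈x⌉ ⌊y⌋).card : ℝ) ≤ y - x + 1 := by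
  rw [Int.card_Icc]
  have h1 := Int.floor_le y
  have h2 := Int.le_ceil x
  rcases le_total 0 (⌊y⌋ + 1 - ⌈x⌉) with h3 | h3
  · have : ((⌊y⌋ + 1 - ⌈x⌉).toNat : ℝ) = ((⌊y⌋ + 1 - ⌈x⌉ : ℤ) : ℝ) := by
      exact_mod_cast Int.toNat_of_nonneg h3
    rw [this]; push_cast; linarith
  · rw [Int.toNat_of_nonpos h3]; push_cast; linarith

lemma farey_cover (c1 d1 : ℝ) (h : c1 ≤ d1) (N : ℕ) (hN : 1 ≤ N)
    (hlog : 6 * (1 + Real.log N) / N ≤ (d1 - c1) / 4) :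
    ∃ S : Finset (ℤ × ℤ), (∀ v ∈ S, (N : ℤ) < 8 * v.2 ∧ v.2 ≤ N ∧ IsCoprime v.1 v.2 ∧
      c1 * v.2 - 1 / N ≤ v.1 ∧ v.1 ≤ d1 * v.2 + 1 / N) ∧ (d1 - c1) / 32 * (N : ℝ) ^ 2 ≤ S.card := by
  classical
  have hN' : (1 : ℝ) ≤ N := by exact_mod_cast hN
  have hN0 : (0 : ℝ) < N := by linarith
  let I : ℤ → Finset ℤ := fun q => Finset.Icc ⌈c1 * q - 1 / N⌉ ⌊d1 * q + 1 / N⌋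
  let P : Finset (Σ _ : ℤ, ℤ) := (Finset.Icc (1 : ℤ) N).sigma I
  let P1 := P.filter (fun x => IsCoprime x.2 x.1)
  have hPm : ∀ x ∈ P, 1 ≤ x.1 ∧ x.1 ≤ N ∧ c1 * x.1 - 1 / N ≤ x.2 ∧ (x.2 : ℝ) ≤ d1 * x.1 + 1 / N := by
    intro x hx
    simp only [P, I, Finset.mem_sigma, Finset.mem_Icc] at hx
    exact ⟨hx.1.1, hx.1.2, Int.ceil_le.mp hx.2.1, Int.le_floor.mp hx.2.2⟩
  have hcov : Set.Icc c1 d1 ⊆ ⋃ x ∈ P1, Metric.closedBall ((x.2 : ℝ) / x.1) (1 / (N * x.1)) := by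
    intro z hz
    obtain ⟨r, hr, hden⟩ := Real.exists_rat_abs_sub_le_and_den_le z (n := N) (by omega)
    have hdp : (0 : ℝ) < r.den := by exact_mod_cast r.den_pos
    have hrc : (r : ℝ) = (r.num : ℝ) / (r.den : ℤ) := by
      conv_lhs => rw [← Rat.num_div_den r]
      push_cast; ring
    have hr2 : |z - (r.num : ℝ) / (r.den : ℤ)| ≤ 1 / (N * (r.den : ℤ)) := by
      rw [← hrc]
      refine hr.trans ?_
      push_cast
      gcongr; linarith
    rw [Set.mem_iUnion₂]
    refine ⟨⟨r.den, r.num⟩, ?_, ?_⟩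
    · simp only [P1, P, I, Finset.mem_filter, Finset.mem_sigma, Finset.mem_Icc]
      push_cast at hr2 ⊢
      have h5 := abs_le.mp hr2
      have e1 : 1 / ((N : ℝ) * r.den) * r.den = 1 / N := by field_simp
      have e2 : (r.num : ℝ) / r.den * r.den = r.num := by field_simp
      refine ⟨⟨⟨by exact_mod_cast r.den_pos, by exact_mod_cast hden⟩, ?_, ?_⟩, ?_⟩
      · rw [Int.ceil_le]
        have h6 : (z - r.num / r.den) * r.den ≤ 1 / (N * r.den) * r.den := by gcongr; exact h5.2
        have h7 : c1 * r.den ≤ z * r.den := by gcongr; exact hz.1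
        rw [sub_mul, e1, e2] at h6; linarith
      · rw [Int.le_floor]
        have h6 : -(1 / ((N : ℝ) * r.den)) * r.den ≤ (z - r.num / r.den) * r.den := by gcongr; exact h5.1
        have h7 : z * r.den ≤ d1 * r.den := by gcongr; exact hz.2
        rw [sub_mul, neg_mul, e1, e2] at h6; linarith
      · exact Rat.isCoprime_num_den r
    · rw [Metric.mem_closedBall, Real.dist_eq]; exact hr2
  have hvol : d1 - c1 ≤ ∑ x ∈ P1, 2 * (1 / ((N : ℝ) * x.1)) := by
    have h1 : volume.real (Set.Icc c1 d1) ≤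
        volume.real (⋃ x ∈ P1, Metric.closedBall ((x.2 : ℝ) / x.1) (1 / (N * x.1))) := by
      refine measureReal_mono hcov ?_
      refine ((measure_biUnion_finset_le _ _).trans_lt ?_).ne
      apply ENNReal.sum_lt_top.mpr
      intro x _; exact measure_closedBall_lt_top
    rw [Real.volume_real_Icc_of_le h] at h1
    refine h1.trans ((measureReal_biUnion_finset_le _ _).trans ?_)
    apply Finset.sum_le_sum
    intro x hx
    rw [Real.volume_real_closedBall]
    have := (hPm x (Finset.mem_filter.mp hx).1).1
    have : (1 : ℝ) ≤ x.1 := by exact_mod_cast this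
    positivity
  rw [← Finset.sum_filter_add_sum_filter_not P1 (fun x => (N : ℤ) < 8 * x.1)] at hvol
  set P2 := P1.filter (fun x => (N : ℤ) < 8 * x.1) with hP2
  have hlarge : ∑ x ∈ P2, 2 * (1 / ((N : ℝ) * x.1)) ≤ P2.card * (16 / (N : ℝ) ^ 2) := by
    rw [← nsmul_eq_mul]
    apply Finset.sum_le_card_nsmul
    intro x hx
    have h1 := (Finset.mem_filter.mp hx).2
    have h1' : (N : ℝ) < 8 * x.1 := by exact_mod_cast h1
    rw [mul_one_div, div_le_div_iff₀ (by nlinarith) (by positivity)]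
    nlinarith
  have hsmall : ∑ x ∈ P1.filter (fun x => ¬ (N : ℤ) < 8 * x.1), 2 * (1 / ((N : ℝ) * x.1))
      ≤ (d1 - c1) / 4 + 6 * (1 + Real.log N) / N := by
    have s1 : P1.filter (fun x => ¬ (N : ℤ) < 8 * x.1) ⊆ (Finset.Icc (1 : ℤ) (N / 8 : ℕ)).sigma I := by
      intro x hx
      simp only [P1, P, Finset.mem_filter, Finset.mem_sigma, Finset.mem_Icc] at hx ⊢
      refine ⟨⟨hx.1.1.1.1, ?_⟩, hx.1.1.2⟩
      have := hx.2
      omega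
    refine (Finset.sum_le_sum_of_subset_of_nonneg s1 ?_).trans ?_
    · intro x hx _
      simp only [Finset.mem_sigma, Finset.mem_Icc] at hx
      have : (1 : ℝ) ≤ x.1 := by exact_mod_cast hx.1.1
      positivity
    rw [Finset.sum_sigma]
    have s2 : ∀ q ∈ Finset.Icc (1 : ℤ) (N / 8 : ℕ), ∑ p ∈ I q, 2 * (1 / ((N : ℝ) * q)) ≤
        2 * (d1 - c1) / N + 6 / N * (1 / (q : ℝ)) := by
      intro q hq
      have hq1 : (1 : ℝ) ≤ q := by exact_mod_cast (Finset.mem_Icc.mp hq).1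
      have hN1 : 1 / (N : ℝ) ≤ 1 := by rw [div_le_one hN0]; exact hN'
      have hN2 : 0 < 1 / (N : ℝ) := by positivity
      rw [Finset.sum_const, nsmul_eq_mul]
      have hc := card_Icc_real_le (c1 * q - 1 / N) (d1 * q + 1 / N) (by nlinarith)
      calc _ ≤ (d1 * q + 1 / N - (c1 * q - 1 / N) + 1) * (2 * (1 / ((N : ℝ) * q))) := by
            gcongr
        _ ≤ ((d1 - c1) * q + 3) * (2 * (1 / ((N : ℝ) * q))) := by
            apply mul_le_mul_of_nonneg_right _ (by positivity)
            linarith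
        _ = _ := by field_simp; ring
    refine (Finset.sum_le_sum s2).trans ?_
    rw [Finset.sum_add_distrib, Finset.sum_const, ← Finset.mul_sum, nsmul_eq_mul]
    have c1' : (((Finset.Icc (1 : ℤ) (N / 8 : ℕ)).card : ℕ) : ℝ) ≤ N / 8 := by
      rw [Int.card_Icc]
      have : (((N / 8 : ℕ) : ℤ) + 1 - 1).toNat = N / 8 := by omega
      rw [this]
      exact Nat.cast_div_le
    have c2 : ∑ q ∈ Finset.Icc (1 : ℤ) (N / 8 : ℕ), 1 / (q : ℝ) ≤ 1 + Real.log N := by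
      have e : ∑ q ∈ Finset.Icc (1 : ℤ) (N / 8 : ℕ), 1 / (q : ℝ) = (harmonic (N / 8) : ℝ) := by
        unfold harmonic
        push_cast
        symm
        refine Finset.sum_nbij' (fun i => (i : ℤ) + 1) (fun q => (q - 1).toNat) ?_ ?_ ?_ ?_ ?_
        · intro k hk; simp only [Finset.mem_Icc, Finset.mem_range] at hk ⊢; omega
        · intro k hk; simp only [Finset.mem_Icc, Finset.mem_range] at hk ⊢; omega
        · intro k hk; simp only [Finset.mem_range] at hk; omega
        · intro k hk; simp only [Finset.mem_Icc] at hk; omega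
        · intro k hk; push_cast; rw [one_div]
      rw [e]
      refine (harmonic_le_one_add_log _).trans ?_
      rcases Nat.eq_zero_or_pos (N / 8) with h0 | h0
      · rw [h0]; simp; exact Real.log_nonneg hN'
      · gcongr
        exact Nat.div_le_self _ _
    have e1 : ((Finset.Icc (1 : ℤ) (N / 8 : ℕ)).card : ℝ) * (2 * (d1 - c1) / N) ≤ (N / 8) * (2 * (d1 - c1) / N) := by
      have : 0 ≤ 2 * (d1 - c1) / N := div_nonneg (by linarith) hN0.le
      gcongr
    have e2 : 6 / (N : ℝ) * ∑ q ∈ Finset.Icc (1 : ℤ) (N / 8 : ℕ), 1 / (q : ℝ) ≤ 6 / (N : ℝ) * (1 + Real.log N) := by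
      gcongr
    have e3 : ((N : ℝ) / 8) * (2 * (d1 - c1) / N) = (d1 - c1) / 4 := by field_simp; ring
    have e4 : 6 / (N : ℝ) * (1 + Real.log N) = 6 * (1 + Real.log N) / N := by ring
    linarith
  refine ⟨P2.image (fun x => (x.2, x.1)), ?_, ?_⟩
  · intro v hv
    obtain ⟨x, hx, rfl⟩ := Finset.mem_image.mp hv
    obtain ⟨hx1, hx2⟩ := Finset.mem_filter.mp hx
    obtain ⟨hx3, hx4⟩ := Finset.mem_filter.mp hx1
    obtain ⟨_, h2, h3, h4⟩ := hPm x hx3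
    exact ⟨hx2, h2, hx4, h3, h4⟩
  · rw [Finset.card_image_of_injective]
    · have : (d1 - c1) / 2 ≤ P2.card * (16 / (N : ℝ) ^ 2) := by linarith
      have e : (P2.card : ℝ) = P2.card * (16 / (N : ℝ) ^ 2) * ((N : ℝ) ^ 2 / 16) := by field_simp
      rw [e]
      calc (d1 - c1) / 32 * (N : ℝ) ^ 2 = (d1 - c1) / 2 * ((N : ℝ) ^ 2 / 16) := by ring
        _ ≤ _ := by gcongr
    · rintro ⟨x, y⟩ ⟨x', y'⟩ h
      simp only [Prod.mk.injEq] at h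
      rw [h.1, h.2]

theorem farey (c d : ℝ) (hcd : c < d) : ∃ N0 : ℕ, ∀ N : ℕ, N0 ≤ N → ∃ G : Finset M2,
    (∀ g ∈ G, IsF c d N g) ∧ (d - c) / 64 * (N : ℝ) ^ 2 ≤ G.card := by
  classical
  have l1 : Filter.Tendsto (fun N : ℕ => 6 * (1 + Real.log N) / N) Filter.atTop (nhds 0) := by
    have h1 : Filter.Tendsto (fun x : ℝ => Real.log x / x) Filter.atTop (nhds 0) :=
      Real.isLittleO_log_id_atTop.tendsto_div_nhds_zero
    have h2 := h1.comp tendsto_natCast_atTop_atTop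
    have h3 := tendsto_one_div_atTop_nhds_zero_nat (𝕜 := ℝ)
    have h4 := (h3.add h2).const_mul 6
    simp only [add_zero, mul_zero] at h4
    refine h4.congr ?_
    intro n; simp only [Function.comp]; ring
  have l2 : Filter.Tendsto (fun N : ℕ => 16 * (1 / (N : ℝ))) Filter.atTop (nhds 0) := by
    have h3 := tendsto_one_div_atTop_nhds_zero_nat (𝕜 := ℝ)
    simpa using h3.const_mul 16
  have ev := ((l1.eventually (gt_mem_nhds (show (0 : ℝ) < (d - c) / 8 by linarith))).and
    (l2.eventually (gt_mem_nhds (show (0 : ℝ) < (d - c) / 4 by linarith)))).and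
    (Filter.eventually_ge_atTop 1)
  obtain ⟨N0, hN0⟩ := Filter.eventually_atTop.mp ev
  refine ⟨N0, fun N hN => ?_⟩
  obtain ⟨⟨h1, h2⟩, h3⟩ := hN0 N hN
  have hN' : (1 : ℝ) ≤ N := by exact_mod_cast h3
  have hNp : (0 : ℝ) < N := by linarith
  obtain ⟨S, hS, hcard⟩ := farey_cover (c + (d - c) / 4) (d - (d - c) / 4) (by linarith) N h3 (by linarith)
  have hex : ∀ v ∈ S, ∃ g : M2, g.p = v.1 ∧ g.q = v.2 ∧ IsF c d N g := by
    intro v hv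
    obtain ⟨a1, a2, a3, a4, a5⟩ := hS v hv
    have a1' : (N : ℝ) < 8 * v.2 := by exact_mod_cast a1
    have i1 : 1 / (N : ℝ) < 8 * v.2 / (N : ℝ) ^ 2 := by
      rw [div_lt_div_iff₀ hNp (by positivity)]; nlinarith
    have i2 : 16 / (N : ℝ) ^ 2 ≤ 16 * (1 / (N : ℝ)) := by
      rw [mul_one_div]
      apply div_le_div_of_nonneg_left (by norm_num) hNp
      nlinarith
    have i3 : 16 / (N : ℝ) ^ 2 * v.2 < (d - c) / 4 * v.2 := by
      have : (0 : ℝ) < v.2 := by linarith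
      exact mul_lt_mul_of_pos_right (by linarith) this
    have i4 : 16 / (N : ℝ) ^ 2 * v.2 = 2 * (8 * v.2 / (N : ℝ) ^ 2) := by ring
    have i0 : 0 < 1 / (N : ℝ) := by positivity
    refine exists_F c d N v.1 v.2 h3 a1 a2 a3 ?_ ?_ <;> nlinarith
  haveI : Nonempty M2 := ⟨⟨0, 0, 0, 0⟩⟩
  choose! f hf using hex
  refine ⟨S.image f, ?_, ?_⟩
  · intro g hg
    obtain ⟨v, hv, rfl⟩ := Finset.mem_image.mp hg
    exact (hf v hv).2.2
  · rw [Finset.card_image_of_injOn]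
    · calc _ = (d - (d - c) / 4 - (c + (d - c) / 4)) / 32 * (N : ℝ) ^ 2 := by ring
        _ ≤ _ := hcard
    · intro v hv w hw h
      have h1 := hf v hv
      have h2 := hf w hw
      ext
      · rw [← h1.1, ← h2.1, h]
      · rw [← h1.2.1, ← h2.2.1, h]

def dk (R : ℕ) (x : ℝ) : ℂ := ∑ k ∈ Finset.Icc (-(R : ℤ)) R, ef (k * x)

lemma card_sym (R : ℕ) : (Finset.Icc (-(R : ℤ)) R).card = 2 * R + 1 := by
  rw [Int.card_Icc]; omega

lemma dk_le (R : ℕ) (x : ℝ) : ‖dk R x‖ ≤ 2 * R + 1 := by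
  unfold dk
  refine (norm_sum_le _ _).trans ?_
  simp only [ef_norm, Finset.sum_const, card_sym]
  simp

lemma dk_mul (R : ℕ) (x : ℝ) : (ef x - 1) * dk R x = ef ((R + 1) * x) - ef (-R * x) := by
  have h : dk R x = ∑ j ∈ Finset.range (2 * R + 1), ef (((j : ℝ) - R) * x) := by
    unfold dk
    symm
    refine Finset.sum_nbij' (fun j => (j : ℤ) - R) (fun k => (k + R).toNat) ?_ ?_ ?_ ?_ ?_
    · intro k hk; simp only [Finset.mem_Icc, Finset.mem_range] at hk ⊢; omega
    · intro k hk; simp only [Finset.mem_Icc, Finset.mem_range] at hk ⊢; omega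
    · intro k hk; simp only [Finset.mem_range] at hk; omega
    · intro k hk; simp only [Finset.mem_Icc] at hk; omega
    · intro k hk; push_cast; rfl
  rw [h, Finset.mul_sum]
  have e : ∀ j : ℕ, (ef x - 1) * ef (((j : ℝ) - R) * x) =
      (fun j : ℕ => ef (((j : ℝ) - R) * x)) (j + 1) - (fun j : ℕ => ef (((j : ℝ) - R) * x)) j := by
    intro j
    have : (((j + 1 : ℕ) : ℝ) - R) * x = x + ((j : ℝ) - R) * x := by push_cast; ring
    simp only [this, ef_add]; ring
  simp_rw [e]
  rw [Finset.sum_range_sub (fun j : ℕ => ef (((j : ℝ) - R) * x))]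
  congr 1
  · congr 1; push_cast; ring
  · congr 1; push_cast; ring

lemma dk_bound (R : ℕ) (x : ℝ) (ρ : ℝ) (hρ : 0 < ρ) (h : ρ ≤ distNearestInt x) :
    ‖dk R x‖ ≤ 1 / (2 * ρ) := by
  have h1 := norm_ef_sub_one_ge x
  have h2 : ‖(ef x - 1) * dk R x‖ ≤ 2 := by
    rw [dk_mul]
    refine (norm_sub_le _ _).trans ?_
    rw [ef_norm, ef_norm]; norm_num
  rw [norm_mul] at h2
  rw [le_div_iff₀ (by positivity)]
  have : 4 * ρ * ‖dk R x‖ ≤ ‖ef x - 1‖ * ‖dk R x‖ := by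
    apply mul_le_mul_of_nonneg_right _ (norm_nonneg _); linarith
  linarith

lemma ef_conj_mul (x y : ℝ) : ef x * (starRingEnd ℂ) (ef y) = ef (x - y) := by
  rw [← ef_neg, ← ef_add]; rfl

lemma norm_sq_sum {ι : Type*} (V : Finset ι) (x : ι → ℝ) :
    ((‖∑ v ∈ V, ef (x v)‖ ^ 2 : ℝ) : ℂ) = ∑ v ∈ V, ∑ w ∈ V, ef (x v - x w) := by
  have := Complex.mul_conj' (∑ v ∈ V, ef (x v))
  push_cast
  rw [← this, map_sum, Finset.sum_mul_sum]
  simp_rw [ef_conj_mul]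

lemma large_sieve {ι : Type*} (V : Finset ι) (θ l : ι → ℝ) (R : ℕ) (ρ K : ℝ) (hρ : 0 < ρ)
    (hK : ∀ v ∈ V, ((V.filter (fun w => distNearestInt (θ v - θ w) < ρ)).card : ℝ) ≤ K) :
    ∑ u ∈ Finset.Icc (-(R : ℤ)) R ×ˢ Finset.Icc (-(R : ℤ)) R, ‖∑ v ∈ V, ef (u.1 * θ v + u.2 * l v)‖ ^ 2
      ≤ (2 * R + 1) * (V.card * ((2 * R + 1) * K + V.card * (1 / (2 * ρ)))) := by
  have e1 : ((∑ u ∈ Finset.Icc (-(R : ℤ)) R ×ˢ Finset.Icc (-(R : ℤ)) R,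
      ‖∑ v ∈ V, ef (u.1 * θ v + u.2 * l v)‖ ^ 2 : ℝ) : ℂ)
      = ∑ v ∈ V, ∑ w ∈ V, dk R (θ v - θ w) * dk R (l v - l w) := by
    rw [Complex.ofReal_sum]
    simp_rw [norm_sq_sum]
    rw [Finset.sum_comm]
    apply Finset.sum_congr rfl
    intro v _
    rw [Finset.sum_comm]
    apply Finset.sum_congr rfl
    intro w _
    unfold dk
    rw [Finset.sum_mul_sum, Finset.sum_product]
    apply Finset.sum_congr rfl; intro i _
    apply Finset.sum_congr rfl; intro j _
    rw [← ef_add]; congr 1; ring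
  have e2 : ∑ u ∈ Finset.Icc (-(R : ℤ)) R ×ˢ Finset.Icc (-(R : ℤ)) R,
      ‖∑ v ∈ V, ef (u.1 * θ v + u.2 * l v)‖ ^ 2 ≤
      ‖∑ v ∈ V, ∑ w ∈ V, dk R (θ v - θ w) * dk R (l v - l w)‖ := by
    rw [← e1, Complex.norm_real]; exact le_abs_self _
  refine e2.trans ((norm_sum_le _ _).trans ?_)
  have e3 : ∀ v ∈ V, ‖∑ w ∈ V, dk R (θ v - θ w) * dk R (l v - l w)‖ ≤
      (2 * R + 1) * ((2 * R + 1) * K + V.card * (1 / (2 * ρ))) := by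
    intro v hv
    refine (norm_sum_le _ _).trans ?_
    have s1 : ∑ w ∈ V, ‖dk R (θ v - θ w) * dk R (l v - l w)‖ ≤
        ∑ w ∈ V, (2 * R + 1) * ((if distNearestInt (θ v - θ w) < ρ then (2 * R + 1 : ℝ) else 0) + 1 / (2 * ρ)) := by
      apply Finset.sum_le_sum
      intro w _
      rw [norm_mul, mul_comm]
      apply mul_le_mul (dk_le _ _) _ (norm_nonneg _) (by positivity)
      split_ifs with hif
      · have := dk_le R (θ v - θ w)
        have : 0 < 1 / (2 * ρ) := by positivity
        linarith
      · rw [zero_add]; exact dk_bound _ _ _ hρ (not_lt.mp hif)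
    refine s1.trans ?_
    rw [← Finset.mul_sum, Finset.sum_add_distrib, Finset.sum_const, nsmul_eq_mul,
      ← Finset.sum_filter, Finset.sum_const, nsmul_eq_mul]
    gcongr (2 * (R : ℝ) + 1) * (?_ + _)
    rw [mul_comm]
    gcongr
    exact hK v hv
  refine (Finset.sum_le_sum e3).trans ?_
  rw [Finset.sum_const, nsmul_eq_mul]
  apply le_of_eq; ring

def Lf (a b : ℝ) (g : M2) : ℝ := a * g.p + b * g.q
def Lf2 (a b : ℝ) (g : M2) : ℝ := a * g.r + b * g.s

lemma dni_dvd_aux (a τ : ℝ) (Q : ℕ) (h : ∀ q : ℕ, 1 ≤ q → q ≤ Q → τ ≤ distNearestInt (q * a))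
    (k : ℤ) (hk : distNearestInt (a * k) < τ) (hkQ : |k| ≤ Q) : k = 0 := by
  by_contra hne
  have := h k.natAbs (by omega) (by rw [Int.abs_eq_natAbs] at hkQ; exact_mod_cast hkQ)
  rw [← dni_int_mul, mul_comm] at this
  linarith

lemma abs_lt_of_div_eq (x y : ℤ) (Q : ℕ) (hQ : 1 ≤ Q) (h : x / Q = y / Q) : |x - y| ≤ Q := by
  have h1 := Int.mul_ediv_add_emod x Q
  have h2 := Int.mul_ediv_add_emod y Q
  have h3 := Int.emod_lt_of_pos x (show (0 : ℤ) < Q by omega)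
  have h4 := Int.emod_lt_of_pos y (show (0 : ℤ) < Q by omega)
  have h5 := Int.emod_nonneg x (show (Q : ℤ) ≠ 0 by omega)
  have h6 := Int.emod_nonneg y (show (Q : ℤ) ≠ 0 by omega)
  rw [h] at h1
  rw [abs_le]; constructor <;> linarith

lemma IsF.p_abs {c d : ℝ} {N : ℕ} {g : M2} (h : IsF c d N g) (B : ℕ) (hc : |c| ≤ B) (hd : |d| ≤ B) :
    -((B * N : ℕ) : ℤ) ≤ g.p ∧ g.p ≤ (B * N : ℕ) := by
  have hq1 : (1 : ℝ) ≤ g.q := by exact_mod_cast h.q1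
  have hqN : (g.q : ℝ) ≤ N := by exact_mod_cast h.hqN
  have h1 := h.hc
  have h2 := h.hd
  have h3 := abs_le.mp hc
  have h4 := abs_le.mp hd
  have hB : (0 : ℝ) ≤ B := by positivity
  constructor
  · have : -((B * N : ℕ) : ℝ) ≤ g.p := by push_cast; nlinarith
    exact_mod_cast this
  · have : (g.p : ℝ) ≤ (B * N : ℕ) := by push_cast; nlinarith
    exact_mod_cast this

lemma nonconc (a b : ℝ) (τ : ℝ) (Q : ℕ) (hQ : 1 ≤ Q)
    (hdich : (∀ q : ℕ, 1 ≤ q → q ≤ Q → τ ≤ distNearestInt (q * a)) ∨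
      (∀ q : ℕ, 1 ≤ q → q ≤ Q → τ ≤ distNearestInt (q * b)))
    (c d : ℝ) (B : ℕ) (hB : 1 ≤ B) (hc : |c| ≤ B) (hd : |d| ≤ B) (N : ℕ) (hN : Q ≤ N)
    (G : Finset M2) (hG : ∀ g ∈ G, IsF c d N g) (x : ℝ) :
    ((G.filter (fun w => distNearestInt (x - Lf a b w) < τ / 2)).card : ℝ) ≤
      8 * B * (N : ℝ) ^ 2 / Q := by
  classical
  set W := G.filter (fun w => distNearestInt (x - Lf a b w) < τ / 2) with hW
  have hWd : ∀ g ∈ W, ∀ g' ∈ W, distNearestInt (a * (g.p - g'.p : ℤ) + b * (g.q - g'.q : ℤ)) < τ := by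
    intro g hg g' hg'
    have h1 := (Finset.mem_filter.mp hg).2
    have h2 := (Finset.mem_filter.mp hg').2
    have h3 := dni_sub_le (x - Lf a b g') (x - Lf a b g)
    have e : x - Lf a b g' - (x - Lf a b g) = a * (g.p - g'.p : ℤ) + b * (g.q - g'.q : ℤ) := by
      unfold Lf; push_cast; ring
    rw [e] at h3; linarith
  have hWG : ∀ g ∈ W, IsF c d N g := fun g hg => hG g (Finset.mem_filter.mp hg).1
  have hQ' : (1 : ℝ) ≤ Q := by exact_mod_cast hQ
  have hNQ : (Q : ℝ) ≤ N := by exact_mod_cast hN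
  have hB' : (1 : ℝ) ≤ B := by exact_mod_cast hB
  rcases hdich with hd1 | hd1
  · -- map to (q, p / Q)
    have hcard : W.card ≤ (Finset.Icc (1 : ℤ) N ×ˢ Finset.Icc (-((B * N : ℕ) : ℤ) / Q) (((B * N : ℕ) : ℤ) / Q)).card := by
      apply Finset.card_le_card_of_injOn (fun g => (g.q, g.p / (Q : ℤ)))
      · intro g hg
        have h := hWG g hg
        have hp := h.p_abs B hc hd
        simp only [Finset.coe_product, Set.mem_prod, Finset.coe_Icc, Set.mem_Icc]
        exact ⟨⟨h.q1, h.hqN⟩, Int.ediv_le_ediv (by omega) hp.1, Int.ediv_le_ediv (by omega) hp.2⟩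
      · intro g hg g' hg' he
        simp only [Prod.mk.injEq] at he
        have h1 := hWd g hg g' hg'
        rw [he.1, sub_self] at h1
        simp only [Int.cast_zero, mul_zero, add_zero] at h1
        have h0 := dni_dvd_aux a τ Q hd1 _ h1 (abs_lt_of_div_eq _ _ Q hQ he.2)
        exact (hWG g hg).ext_pq (hWG g' hg') (by omega) he.1
    rw [Finset.card_product, Int.card_Icc, Int.card_Icc] at hcard
    have e1 : ((N : ℤ) + 1 - 1).toNat = N := by omega
    rw [e1] at hcard
    have hb : ((((B * N : ℕ) : ℤ) / Q + 1 - -((B * N : ℕ) : ℤ) / Q).toNat : ℝ) ≤ 2 * (B * N / Q) + 2 := by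
      have f1 : ((((B * N : ℕ) : ℤ) / Q : ℤ) : ℝ) ≤ B * N / Q := by
        rw [le_div_iff₀ (by linarith)]
        have := Int.ediv_mul_le ((B * N : ℕ) : ℤ) (show (Q : ℤ) ≠ 0 by omega)
        exact_mod_cast this
      have f2 : -(B * N / Q : ℝ) - 1 ≤ ((-((B * N : ℕ) : ℤ) / Q : ℤ) : ℝ) := by
        have := Int.lt_ediv_add_one_mul_self (-((B * N : ℕ) : ℤ)) (show (0 : ℤ) < Q by omega)
        have h7 : (-(B * N) : ℝ) < ((-((B * N : ℕ) : ℤ) / Q : ℤ) + 1) * Q := by exact_mod_cast this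
        have h8 : -(B * N / Q : ℝ) = (-(B * N)) / Q := by ring
        rw [h8, sub_le_iff_le_add, div_le_iff₀ (by linarith)]
        exact h7.le
      have f3 : 0 ≤ ((B * N : ℕ) : ℤ) / Q + 1 - -((B * N : ℕ) : ℤ) / Q := by
        have : -((B * N : ℕ) : ℤ) / Q ≤ ((B * N : ℕ) : ℤ) / Q := Int.ediv_le_ediv (by omega) (by omega)
        omega
      have f4 : ((((B * N : ℕ) : ℤ) / Q + 1 - -((B * N : ℕ) : ℤ) / Q).toNat : ℝ) =
          ((((B * N : ℕ) : ℤ) / Q + 1 - -((B * N : ℕ) : ℤ) / Q : ℤ) : ℝ) := by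
        exact_mod_cast Int.toNat_of_nonneg f3
      rw [f4]
      rw [Int.cast_sub, Int.cast_add, Int.cast_one]
      linarith
    have hcard' : (W.card : ℝ) ≤ N * (2 * (B * N / Q) + 2) := by
      refine (Nat.cast_le.mpr hcard).trans ?_
      rw [Nat.cast_mul]
      gcongr
    refine hcard'.trans ?_
    have : 1 ≤ (B : ℝ) * N / Q := by rw [le_div_iff₀ (by linarith)]; nlinarith
    calc (N : ℝ) * (2 * (B * N / Q) + 2) ≤ N * (8 * (B * N / Q)) := by gcongr; linarith
      _ = _ := by ring
  · have hcard : W.card ≤ (Finset.Icc (-((B * N : ℕ) : ℤ)) ((B * N : ℕ) : ℤ) ×ˢ Finset.Icc (0 : ℤ) ((N : ℤ) / Q)).card := by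
      apply Finset.card_le_card_of_injOn (fun g => (g.p, g.q / (Q : ℤ)))
      · intro g hg
        have h := hWG g hg
        have hp := h.p_abs B hc hd
        have := h.q1
        simp only [Finset.coe_product, Set.mem_prod, Finset.coe_Icc, Set.mem_Icc]
        exact ⟨hp, Int.ediv_nonneg (by omega) (by omega), Int.ediv_le_ediv (by omega) h.hqN⟩
      · intro g hg g' hg' he
        simp only [Prod.mk.injEq] at he
        have h1 := hWd g hg g' hg'
        rw [he.1, sub_self] at h1
        simp only [Int.cast_zero, mul_zero, zero_add] at h1
        have h0 := dni_dvd_aux b τ Q hd1 _ h1 (abs_lt_of_div_eq _ _ Q hQ he.2)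
        exact (hWG g hg).ext_pq (hWG g' hg') he.1 (by omega)
    rw [Finset.card_product, card_sym, Int.card_Icc] at hcard
    have e1 : ((N : ℤ) / Q + 1 - 0).toNat = N / Q + 1 := by
      rw [show ((N : ℤ) / Q) = ((N / Q : ℕ) : ℤ) from (Int.natCast_ediv N Q).symm]
      generalize N / Q = z
      omega
    rw [e1] at hcard
    have hcard' : (W.card : ℝ) ≤ (2 * (B * N) + 1) * (N / Q + 1) := by
      refine (Nat.cast_le.mpr hcard).trans ?_
      push_cast
      gcongr
      exact Nat.cast_div_le
    refine hcard'.trans ?_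
    have h1 : 1 ≤ (N : ℝ) / Q := by rw [le_div_iff₀ (by linarith)]; linarith
    have h2 : 1 ≤ (B : ℝ) * N := by nlinarith
    calc (2 * ((B : ℝ) * N) + 1) * (N / Q + 1) ≤ (4 * (B * N)) * (2 * (N / Q)) := by
          gcongr <;> linarith
      _ = _ := by ring

lemma card_le_F (c d : ℝ) (h0 : c ≤ d) (h1 : d - c ≤ 1) (N : ℕ) (G : Finset M2)
    (hG : ∀ g ∈ G, IsF c d N g) : (G.card : ℝ) ≤ 2 * (N : ℝ) ^ 2 := by
  classical
  have hcard : G.card ≤ ((Finset.Icc (1 : ℤ) N).sigma (fun q => Finset.Icc ⌈c * q⌉ ⌊d * q⌋)).card := by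
    apply Finset.card_le_card_of_injOn (fun g => (⟨g.q, g.p⟩ : Σ _ : ℤ, ℤ))
    · intro g hg
      have h := hG g hg
      simp only [Finset.coe_sigma, Set.mem_sigma_iff, Finset.coe_Icc, Set.mem_Icc]
      exact ⟨⟨h.q1, h.hqN⟩, Int.ceil_le.mpr h.hc.le, Int.le_floor.mpr h.hd⟩
    · intro g hg g' hg' he
      simp only [Sigma.mk.injEq, heq_eq_eq] at he
      exact (hG g hg).ext_pq (hG g' hg') he.2 he.1
  rw [Finset.card_sigma] at hcard
  have h2 : ∀ q ∈ Finset.Icc (1 : ℤ) N, (((Finset.Icc ⌈c * q⌉ ⌊d * q⌋).card : ℕ) : ℝ) ≤ N + 1 := by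
    intro q hq
    have hq' := Finset.mem_Icc.mp hq
    have q1 : (1 : ℝ) ≤ q := by exact_mod_cast hq'.1
    have q2 : (q : ℝ) ≤ N := by exact_mod_cast hq'.2
    refine (card_Icc_real_le _ _ (by nlinarith)).trans ?_
    nlinarith
  have h3 : ((∑ q ∈ Finset.Icc (1 : ℤ) N, (Finset.Icc ⌈c * q⌉ ⌊d * q⌋).card : ℕ) : ℝ) ≤ N * (N + 1) := by
    push_cast
    refine (Finset.sum_le_sum h2).trans ?_
    rw [Finset.sum_const, Int.card_Icc, nsmul_eq_mul]
    have e1 : ((N : ℤ) + 1 - 1).toNat = N := by omega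
    rw [e1]
  have h4 : (G.card : ℝ) ≤ N * (N + 1) := (Nat.cast_le.mpr hcard).trans h3
  rcases Nat.eq_zero_or_pos N with h | h
  · subst h; simpa using h4
  · have : (1 : ℝ) ≤ N := by exact_mod_cast h
    nlinarith

def u1 (g : M2) (m1 m2 : ℤ) : ℤ := g.p * m1 + g.r * m2
def u2 (g : M2) (m1 m2 : ℤ) : ℤ := g.q * m1 + g.s * m2

lemma partA (N Z : ℕ) (hZ : 8 ≤ Z) (hZN : Z ≤ N) (G : Finset M2) (hG : ∀ g ∈ G, IsF 1 2 N g)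
    (m1 m2 : ℤ) (hm : ¬ (m1 = 0 ∧ m2 = 0)) :
    ((G.filter (fun g => |u2 g m1 m2| * Z < N)).card : ℝ) ≤ 3 * (N : ℝ) ^ 2 / Z := by
  classical
  have hZ0 : (0 : ℝ) < Z := by have : (8 : ℝ) ≤ Z := by exact_mod_cast hZ
                               linarith
  by_cases h2 : m2 = 0
  · have : G.filter (fun g => |u2 g m1 m2| * Z < N) = ∅ := by
      apply Finset.filter_eq_empty_iff.mpr
      intro g hg
      have h := hG g hg
      have hm1 : m1 ≠ 0 := fun h1 => hm ⟨h1, h2⟩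
      have h8 := h.hq8
      have hq := h.q1
      have e : |u2 g m1 m2| = g.q * |m1| := by
        unfold u2; rw [h2, mul_zero, add_zero, abs_mul, abs_of_pos (by omega)]
      rw [e]
      have : 1 ≤ |m1| := Int.one_le_abs hm1
      have hZ' : (8 : ℤ) ≤ Z := by exact_mod_cast hZ
      have h1 : g.q * 1 ≤ g.q * |m1| := by gcongr
      nlinarith
    rw [this]; simp; positivity
  · set W := G.filter (fun g => |u2 g m1 m2| * Z < N) with hW
    have hcard : W.card ≤ (Finset.Icc (1 : ℤ) N ×ˢ Finset.Icc (-((N / Z : ℕ) : ℤ)) (N / Z : ℕ)).card := by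
      apply Finset.card_le_card_of_injOn (fun g => (g.q, u2 g m1 m2))
      · intro g hg
        obtain ⟨hg1, hg2⟩ := Finset.mem_filter.mp hg
        have h := hG g hg1
        simp only [Finset.coe_product, Set.mem_prod, Finset.coe_Icc, Set.mem_Icc]
        refine ⟨⟨h.q1, h.hqN⟩, ?_⟩
        rw [← abs_le, Int.natCast_ediv]
        exact Int.le_ediv_of_mul_le (by omega) hg2.le
      · intro g hg g' hg' he
        simp only [Prod.mk.injEq] at he
        have h := hG g (Finset.mem_filter.mp hg).1
        have h' := hG g' (Finset.mem_filter.mp hg').1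
        refine h.ext_qs (by omega) h' he.1 ?_
        have := he.2
        unfold u2 at this
        rw [he.1] at this
        exact mul_right_cancel₀ h2 (by linarith)
    rw [Finset.card_product, card_sym, Int.card_Icc] at hcard
    have e1 : ((N : ℤ) + 1 - 1).toNat = N := by omega
    rw [e1] at hcard
    have hcard' : (W.card : ℝ) ≤ N * (2 * (N / Z) + 1) := by
      refine (Nat.cast_le.mpr hcard).trans ?_
      push_cast
      gcongr
      exact Nat.cast_div_le
    have hNZ : 1 ≤ (N : ℝ) / Z := by rw [le_div_iff₀ hZ0, one_mul]; exact_mod_cast hZN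
    calc (W.card : ℝ) ≤ N * (2 * (N / Z) + 1) := hcard'
      _ ≤ N * (3 * (N / Z)) := by gcongr; linarith
      _ = _ := by ring

lemma mult (N Z M : ℕ) (hM : 1 ≤ M) (hZ : 8 ≤ Z) (hZN : Z ≤ N) (G : Finset M2)
    (hG : ∀ g ∈ G, IsF 1 2 N g) (m1 m2 : ℤ) (hm2 : |m2| ≤ M) (v1 v2 : ℤ) :
    ((G.filter (fun g => (¬ |u2 g m1 m2| * Z < N) ∧ u1 g m1 m2 = v1 ∧ u2 g m1 m2 = v2)).card : ℝ)
      ≤ 18 * (M * Z) := by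
  classical
  set W := G.filter (fun g => (¬ |u2 g m1 m2| * Z < N) ∧ u1 g m1 m2 = v1 ∧ u2 g m1 m2 = v2) with hW
  have hN0 : (0 : ℝ) < N := by exact_mod_cast (show 0 < N by omega)
  have hZ0 : (0 : ℝ) < Z := by exact_mod_cast (show 0 < Z by omega)
  set A : ℝ := (N : ℝ) ^ 2 * (v1 / v2)
  have key : ∀ g ∈ W, |(N : ℝ) ^ 2 * (g.p / g.q) - A| ≤ 8 * (M * Z) := by
    intro g hg
    obtain ⟨hg1, hg2, hg3, hg4⟩ := Finset.mem_filter.mp hg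
    have h := hG g hg1
    rw [hg4] at hg2
    have hv2 : (N : ℝ) ≤ |(v2 : ℝ)| * Z := by exact_mod_cast not_lt.mp hg2
    have hv0 : (v2 : ℝ) ≠ 0 := by
      intro h0; rw [h0] at hv2; simp at hv2; omega
    have hvp : 0 < |(v2 : ℝ)| := abs_pos.mpr hv0
    have hq : (0 : ℝ) < g.q := by exact_mod_cast h.q1
    have hq8 : (N : ℝ) < 8 * g.q := by exact_mod_cast h.hq8
    have hm2' : |(m2 : ℝ)| ≤ M := by exact_mod_cast hm2
    have e : g.p * v2 - g.q * v1 = m2 := by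
      rw [← hg3, ← hg4]; unfold u1 u2
      linear_combination m2 * h.det
    have e' : (g.p : ℝ) * v2 - g.q * v1 = m2 := by exact_mod_cast e
    have e2 : (N : ℝ) ^ 2 * (g.p / g.q) - A = (N : ℝ) ^ 2 * m2 / (g.q * v2) := by
      simp only [A]; rw [← e']; field_simp
    rw [e2, abs_div, abs_mul, abs_mul, abs_of_pos hq, abs_of_pos (by positivity : (0 : ℝ) < (N : ℝ) ^ 2),
      div_le_iff₀ (by positivity)]
    have i1 : (N : ℝ) * N ≤ (8 * g.q) * (|(v2 : ℝ)| * Z) := by gcongr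
    calc (N : ℝ) ^ 2 * |(m2 : ℝ)| ≤ ((8 * g.q) * (|(v2 : ℝ)| * Z)) * M := by
          rw [sq]; gcongr
      _ = _ := by ring
  have hcard : W.card ≤ (Finset.Icc ⌊A - 8 * (M * Z)⌋ ⌊A + 8 * (M * Z)⌋).card := by
    apply Finset.card_le_card_of_injOn (fun g => ⌊(N : ℝ) ^ 2 * (g.p / g.q)⌋)
    · intro g hg
      have := abs_le.mp (key g hg)
      simp only [Finset.coe_Icc, Set.mem_Icc]
      exact ⟨Int.floor_le_floor (by linarith), Int.floor_le_floor (by linarith)⟩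
    · intro g hg g' hg' he
      simp only at he
      have h := hG g (Finset.mem_filter.mp hg).1
      have h' := hG g' (Finset.mem_filter.mp hg').1
      have hlt := Int.abs_sub_lt_one_of_floor_eq_floor he
      have hq : (0 : ℝ) < g.q := by exact_mod_cast h.q1
      have hq' : (0 : ℝ) < g'.q := by exact_mod_cast h'.q1
      have hqN : (g.q : ℝ) ≤ N := by exact_mod_cast h.hqN
      have hqN' : (g'.q : ℝ) ≤ N := by exact_mod_cast h'.hqN
      have e2 : (N : ℝ) ^ 2 * (g.p / g.q) - (N : ℝ) ^ 2 * (g'.p / g'.q) =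
          (N : ℝ) ^ 2 * ((g.p * g'.q - g'.p * g.q : ℤ) : ℝ) / (g.q * g'.q) := by
        push_cast; field_simp
      rw [e2, abs_div, abs_mul, abs_of_pos (mul_pos hq hq'),
        abs_of_pos (by positivity : (0 : ℝ) < (N : ℝ) ^ 2), div_lt_iff₀ (by positivity), one_mul] at hlt
      have z : g.p * g'.q - g'.p * g.q = 0 := by
        by_contra hne
        have : (1 : ℝ) ≤ |((g.p * g'.q - g'.p * g.q : ℤ) : ℝ)| := by
          exact_mod_cast Int.one_le_abs hne
        have : (g.q : ℝ) * g'.q ≤ N * N := by gcongr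
        nlinarith
      have e : g.p * g'.q = g'.p * g.q := by omega
      have hc : IsCoprime g.q g.p := ⟨-g.r, g.s, by linear_combination h.det⟩
      have hc' : IsCoprime g'.q g'.p := ⟨-g'.r, g'.s, by linear_combination h'.det⟩
      have d1 : g.q ∣ g'.q := hc.dvd_of_dvd_mul_left ⟨g'.p, by linear_combination e⟩
      have d2 : g'.q ∣ g.q := hc'.dvd_of_dvd_mul_left ⟨g.p, by linear_combination -e⟩
      have hq : g.q = g'.q := Int.dvd_antisymm (by have := h.q1; omega) (by have := h'.q1; omega) d1 d2
      refine h.ext_pq h' ?_ hq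
      rw [hq] at e
      have := h'.q1
      exact mul_right_cancel₀ (by omega) e
  have hMZ : (1 : ℝ) ≤ M * Z := by exact_mod_cast Nat.mul_pos hM (by omega)
  rw [Int.card_Icc] at hcard
  have f3 : 0 ≤ ⌊A + 8 * (M * Z)⌋ + 1 - ⌊A - 8 * (M * Z)⌋ := by
    have : ⌊A - 8 * (M * Z)⌋ ≤ ⌊A + 8 * (M * Z)⌋ := Int.floor_le_floor (by linarith)
    omega
  have f4 : ((⌊A + 8 * (M * Z)⌋ + 1 - ⌊A - 8 * (M * Z)⌋).toNat : ℝ) =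
      ((⌊A + 8 * (M * Z)⌋ + 1 - ⌊A - 8 * (M * Z)⌋ : ℤ) : ℝ) := by
    exact_mod_cast Int.toNat_of_nonneg f3
  have f5 : (W.card : ℝ) ≤ ((⌊A + 8 * (M * Z)⌋ + 1 - ⌊A - 8 * (M * Z)⌋ : ℤ) : ℝ) := by
    rw [← f4]; exact_mod_cast hcard
  push_cast at f5
  have := Int.floor_le (A + 8 * (M * Z))
  have := Int.sub_one_lt_floor (A - 8 * (M * Z))
  linarith

lemma IsF.bounds12 {N : ℕ} {g : M2} (h : IsF 1 2 N g) :
    1 ≤ g.p ∧ g.p ≤ 2 * N ∧ 0 ≤ g.r ∧ g.r ≤ 2 * N := by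
  have hq := h.q1
  have a1 : g.q < g.p := by have := h.hc; rw [one_mul] at this; exact_mod_cast this
  have a2 : g.p ≤ 2 * g.q := by exact_mod_cast h.hd
  have a3 := h.hqN
  have a4 := h.hs1
  have a5 := h.hsN
  have a6 := h.det
  refine ⟨by omega, by omega, ?_, ?_⟩
  · by_contra hc
    have : g.r ≤ -1 := by omega
    nlinarith
  · by_contra hc
    have : 2 * g.s + 1 ≤ g.r := by omega
    nlinarith

lemma abs_lin_le (x y m1 m2 : ℤ) (K M : ℕ) (hx : |x| ≤ K) (hy : |y| ≤ K) (h1 : |m1| ≤ M) (h2 : |m2| ≤ M) :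
    |x * m1 + y * m2| ≤ 2 * K * M := by
  refine (abs_add_le _ _).trans ?_
  rw [abs_mul, abs_mul]
  have e1 : |x| * |m1| ≤ K * M := by gcongr
  have e2 : |y| * |m2| ≤ K * M := by gcongr
  linarith

theorem expsum (a b : ℝ) (E0 : ℕ) (δ : ℝ) (hδ : 0 < δ)
    (hdich : ∀ Q : ℕ, 1 ≤ Q →
      (∀ q : ℕ, 1 ≤ q → q ≤ Q → δ / (Q : ℝ) ^ E0 ≤ distNearestInt (q * a)) ∨
      (∀ q : ℕ, 1 ≤ q → q ≤ Q → δ / (Q : ℝ) ^ E0 ≤ distNearestInt (q * b)))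
    (c d : ℝ) (h0 : c ≤ d) (h1 : d - c ≤ 1) (B : ℕ) (hB : 1 ≤ B) (hc : |c| ≤ B) (hd : |d| ≤ B)
    (M Z N : ℕ) (hM : 1 ≤ M) (hZ : 8 ≤ Z) (hNQ : M ^ 3 * Z ^ 3 ≤ N)
    (hNδ : ((M ^ 3 * Z ^ 3 : ℕ) : ℝ) ^ (E0 + 1) ≤ δ * N)
    (G1 G2 : Finset M2) (hG1 : ∀ g ∈ G1, IsF c d N g) (hG2 : ∀ g ∈ G2, IsF 1 2 N g)
    (m1 m2 : ℤ) (hm1 : |m1| ≤ M) (hm2 : |m2| ≤ M) (hm : ¬ (m1 = 0 ∧ m2 = 0)) :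
    ‖∑ g2 ∈ G2, ∑ g1 ∈ G1, ef (u1 g2 m1 m2 * Lf a b g1 + u2 g2 m1 m2 * Lf2 a b g1)‖
      ≤ 50000 * B * (N : ℝ) ^ 4 / Z := by
  classical
  set Q : ℕ := M ^ 3 * Z ^ 3 with hQ
  have hQ1 : 1 ≤ Q := Nat.mul_pos (pow_pos (by omega) _) (pow_pos (by omega) _)
  have hZQ : Z ≤ Q := by
    calc Z ≤ Z ^ 3 := Nat.le_self_pow (by norm_num) _
      _ ≤ M ^ 3 * Z ^ 3 := Nat.le_mul_of_pos_left _ (pow_pos (by omega) _)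
  have hZN : Z ≤ N := hZQ.trans hNQ
  have hM' : (1 : ℝ) ≤ M := by exact_mod_cast hM
  have hB' : (1 : ℝ) ≤ B := by exact_mod_cast hB
  have hQ' : (1 : ℝ) ≤ Q := by exact_mod_cast hQ1
  have hZ' : (8 : ℝ) ≤ Z := by exact_mod_cast hZ
  have hZN' : (Z : ℝ) ≤ N := by exact_mod_cast hZN
  have hN' : (1 : ℝ) ≤ N := by linarith
  have hc1 := card_le_F c d h0 h1 N G1 hG1
  have hc2 := card_le_F 1 2 (by norm_num) (by norm_num) N G2 hG2
  set F : ℤ × ℤ → ℂ := fun u => ∑ g1 ∈ G1, ef (u.1 * Lf a b g1 + u.2 * Lf2 a b g1) with hF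
  have hFle : ∀ u, ‖F u‖ ≤ 2 * (N : ℝ) ^ 2 := by
    intro u
    refine (norm_sum_le _ _).trans ?_
    simp only [ef_norm, Finset.sum_const, nsmul_eq_mul, mul_one]
    exact hc1
  set R : ℕ := 4 * N * M with hR
  have hls : ∑ u ∈ Finset.Icc (-(R : ℤ)) R ×ˢ Finset.Icc (-(R : ℤ)) R, ‖F u‖ ^ 2 ≤
      1332 * B * (M : ℝ) ^ 2 * (N : ℝ) ^ 6 / Q := by
    set τ := δ / (Q : ℝ) ^ E0 with hτ
    have hτ0 : 0 < τ := by positivity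
    have hnc := fun x => nonconc a b τ Q hQ1 (hdich Q hQ1) c d B hB hc hd N hNQ G1 hG1 x
    refine (large_sieve G1 (Lf a b) (Lf2 a b) R (τ / 2) (8 * B * (N : ℝ) ^ 2 / Q) (by positivity)
      (fun v _ => hnc _)).trans ?_
    have r1 : (2 * (R : ℝ) + 1) ≤ 9 * N * M := by
      rw [hR]; push_cast; nlinarith
    have r2 : 1 / (2 * (τ / 2)) ≤ N / Q := by
      have e : 2 * (τ / 2) = τ := by ring
      rw [e, hτ, one_div_div, div_le_div_iff₀ hδ (by linarith)]
      calc (Q : ℝ) ^ E0 * Q = (Q : ℝ) ^ (E0 + 1) := (pow_succ _ _).symm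
        _ ≤ δ * N := hNδ
        _ = _ := mul_comm _ _
    calc (2 * (R : ℝ) + 1) * (G1.card * ((2 * R + 1) * (8 * B * (N : ℝ) ^ 2 / Q) + G1.card * (1 / (2 * (τ / 2)))))
        ≤ (9 * N * M) * (2 * (N : ℝ) ^ 2 * ((9 * N * M) * (8 * B * (N : ℝ) ^ 2 / Q) + 2 * (N : ℝ) ^ 2 * (N / Q))) := by
          gcongr
      _ = 18 * M * (N : ℝ) ^ 6 / Q * (72 * (B * M) + 2) := by ring
      _ ≤ 18 * M * (N : ℝ) ^ 6 / Q * (74 * (B * M)) := by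
          gcongr
          have : 1 ≤ (B : ℝ) * M := by nlinarith
          linarith
      _ = _ := by ring
  -- split
  set uu : M2 → ℤ × ℤ := fun g => (u1 g m1 m2, u2 g m1 m2) with huu
  have hT : ∑ g2 ∈ G2, ∑ g1 ∈ G1, ef (u1 g2 m1 m2 * Lf a b g1 + u2 g2 m1 m2 * Lf2 a b g1)
      = ∑ g2 ∈ G2, F (uu g2) := rfl
  rw [hT, ← Finset.sum_filter_add_sum_filter_not G2 (fun g => |u2 g m1 m2| * Z < N)]
  have hbad : ‖∑ g ∈ G2.filter (fun g => |u2 g m1 m2| * Z < N), F (uu g)‖ ≤ 6 * (N : ℝ) ^ 4 / Z := by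
    refine (norm_sum_le _ _).trans ?_
    refine (Finset.sum_le_card_nsmul _ _ _ (fun g _ => hFle (uu g))).trans ?_
    rw [nsmul_eq_mul]
    have hA := partA N Z hZ hZN G2 hG2 m1 m2 hm
    calc _ ≤ 3 * (N : ℝ) ^ 2 / Z * (2 * (N : ℝ) ^ 2) := by gcongr
      _ = _ := by ring
  set V := G2.filter (fun g => ¬ |u2 g m1 m2| * Z < N) with hV
  have hVcard : (V.card : ℝ) ≤ 2 * (N : ℝ) ^ 2 :=
    (Nat.cast_le.mpr (Finset.card_filter_le _ _)).trans hc2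
  have hsq : ∑ g ∈ V, ‖F (uu g)‖ ^ 2 ≤ 18 * (M * Z) * (1332 * B * (M : ℝ) ^ 2 * (N : ℝ) ^ 6 / Q) := by
    set Bx := Finset.Icc (-(R : ℤ)) R ×ˢ Finset.Icc (-(R : ℤ)) R
    have hmap : ∀ g ∈ V, uu g ∈ Bx := by
      intro g hg
      have h := hG2 g (Finset.mem_filter.mp hg).1
      obtain ⟨b1, b2, b3, b4⟩ := h.bounds12
      have c1 := h.q1
      have c2 := h.hqN
      have c3 := h.hs1
      have c4 := h.hsN
      have e : (R : ℤ) = 2 * (2 * N : ℕ) * M := by rw [hR]; push_cast; ring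
      simp only [Bx, Finset.mem_product, Finset.mem_Icc, huu, ← abs_le, e]
      constructor
      · apply abs_lin_le _ _ _ _ _ _ _ _ hm1 hm2 <;> rw [abs_le] <;> constructor <;> push_cast <;> linarith
      · apply abs_lin_le _ _ _ _ _ _ _ _ hm1 hm2 <;> rw [abs_le] <;> constructor <;> push_cast <;> linarith
    rw [← Finset.sum_fiberwise_of_maps_to hmap]
    have : ∀ u ∈ Bx, ∑ g ∈ V.filter (fun g => uu g = u), ‖F (uu g)‖ ^ 2 ≤ 18 * (M * Z) * ‖F u‖ ^ 2 := by
      intro u _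
      have e : ∑ g ∈ V.filter (fun g => uu g = u), ‖F (uu g)‖ ^ 2 =
          ((V.filter (fun g => uu g = u)).card : ℝ) * ‖F u‖ ^ 2 := by
        rw [← nsmul_eq_mul]
        apply Finset.sum_eq_card_nsmul
        intro g hg; rw [(Finset.mem_filter.mp hg).2]
      rw [e]
      gcongr
      refine le_trans ?_ (mult N Z M hM hZ hZN G2 hG2 m1 m2 hm2 u.1 u.2)
      apply le_of_eq
      congr 2
      rw [hV, Finset.filter_filter]
      apply Finset.filter_congr
      intro g _
      simp only [huu, Prod.ext_iff]
    refine (Finset.sum_le_sum this).trans ?_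
    rw [← Finset.mul_sum]
    gcongr
  have hgood : ‖∑ g ∈ V, F (uu g)‖ ≤ 47952 * B * (N : ℝ) ^ 4 / Z := by
    refine (norm_sum_le _ _).trans ?_
    have cs := sq_sum_le_card_mul_sum_sq (s := V) (f := fun g => ‖F (uu g)‖)
    have : (∑ g ∈ V, ‖F (uu g)‖) ^ 2 ≤ (47952 * B * (N : ℝ) ^ 4 / Z) ^ 2 := by
      refine cs.trans ?_
      have hQr : (Q : ℝ) = (M : ℝ) ^ 3 * (Z : ℝ) ^ 3 := by rw [hQ]; push_cast; ring
      calc (V.card : ℝ) * ∑ g ∈ V, ‖F (uu g)‖ ^ 2 ≤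
            (2 * (N : ℝ) ^ 2) * (18 * (M * Z) * (1332 * B * (M : ℝ) ^ 2 * (N : ℝ) ^ 6 / Q)) := by
            gcongr
        _ = (47952 * B) * ((N : ℝ) ^ 8 / (Z : ℝ) ^ 2) := by
            rw [hQr]
            have : (Z : ℝ) ≠ 0 := by linarith
            field_simp
            norm_num
        _ ≤ (47952 * B) ^ 2 * ((N : ℝ) ^ 8 / (Z : ℝ) ^ 2) := by
            gcongr
            nlinarith
        _ = _ := by ring
    exact le_of_sq_le_sq this (by positivity)
  refine (norm_add_le _ _).trans ((add_le_add hbad hgood).trans ?_)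
  rw [← add_div]
  gcongr
  have : (N : ℝ) ^ 4 ≤ B * (N : ℝ) ^ 4 := le_mul_of_one_le_left (by positivity) hB'
  have h0 : (0:ℝ) ≤ (B:ℝ)*(N:ℝ)^4 := by positivity
  nlinarith

def Ut (t : ℝ) (X : ℕ) : Finset (ℕ × ℕ) := by
  classical
  exact ((Finset.Icc 1 (3 * X)) ×ˢ (Finset.Icc 1 X)).filter
    (fun u => Nat.Coprime u.1 u.2 ∧ t * u.2 < u.1 ∧ (u.1 : ℝ) ≤ t * u.2 + u.2)

lemma mem_Ut (t : ℝ) (X : ℕ) (u : ℕ × ℕ) : u ∈ Ut t X ↔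
    (1 ≤ u.1 ∧ u.1 ≤ 3 * X) ∧ (1 ≤ u.2 ∧ u.2 ≤ X) ∧ Nat.Coprime u.1 u.2 ∧ t * u.2 < u.1 ∧
      (u.1 : ℝ) ≤ t * u.2 + u.2 := by
  classical
  simp only [Ut, Finset.mem_filter, Finset.mem_product, Finset.mem_Icc]
  tauto

lemma card_Ut (t : ℝ) (X : ℕ) : (Ut t X).card ≤ 3 * X ^ 2 := by
  classical
  refine (Finset.card_filter_le _ _).trans ?_
  rw [Finset.card_product]
  simp
  nlinarith

/-- tail bound -/
lemma tail_sq (ξ : ℝ) (hξ : 0 < ξ) (K : ℕ) (S : Finset ℕ) (hS : ∀ g ∈ S, 1 ≤ g ∧ g ≤ K ∧ 1 ≤ g * ξ) :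
    ∑ g ∈ S, ((g : ℝ) ^ 2)⁻¹ ≤ 2 * min 1 ξ := by
  set D := max 1 ⌈1 / ξ⌉₊ with hD
  have hD1 : 1 ≤ D := le_max_left _ _
  have h1 : ∑ g ∈ S, ((g : ℝ) ^ 2)⁻¹ ≤ ∑ g ∈ Finset.Ioo (D - 1) (K + 1), ((g : ℝ) ^ 2)⁻¹ := by
    apply Finset.sum_le_sum_of_subset_of_nonneg
    · intro g hg
      obtain ⟨a1, a2, a3⟩ := hS g hg
      have : ⌈1 / ξ⌉₊ ≤ g := by
        apply Nat.ceil_le.2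
        rw [div_le_iff₀ hξ]; exact a3
      have : D ≤ g := max_le a1 this
      simp only [Finset.mem_Ioo]; omega
    · intros; positivity
  refine h1.trans ((sum_Ioo_inv_sq_le _ _).trans ?_)
  have e : ((D - 1 : ℕ) : ℝ) + 1 = D := by
    push_cast [Nat.cast_sub hD1]; ring
  rw [e]
  have hDr : (1 : ℝ) ≤ D := by exact_mod_cast hD1
  have h2 : 1 / ξ ≤ D := (Nat.le_ceil _).trans (by exact_mod_cast le_max_right _ _)
  rw [div_eq_mul_inv]
  gcongr
  apply le_min
  · exact inv_le_one_of_one_le₀ hDr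
  · rw [inv_le_comm₀ (by linarith) hξ]; rwa [one_div] at h2

lemma pair_sum (Y : ℕ) (hY : 2 ≤ Real.log Y) :
    (Real.log Y) ^ 2 / 4 ≤ ∑ y ∈ Finset.Ioc Y (Y ^ 2), ∑ i ∈ Finset.Ioc 1 Y, (1 : ℝ) / (y * i) := by
  have hY1 : 1 ≤ Y := by
    rcases Nat.eq_zero_or_pos Y with h | h
    · subst h; simp at hY; linarith
    · exact h
  have hH : ∀ n : ℕ, ((harmonic n : ℚ) : ℝ) = ∑ i ∈ Finset.Ioc 0 n, (1 : ℝ) / i := by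
    intro n
    rw [harmonic_eq_sum_Icc]
    push_cast
    apply Finset.sum_congr
    · ext; simp; omega
    · intros; simp
  have split : ∀ m n : ℕ, m ≤ n → ∑ i ∈ Finset.Ioc m n, (1 : ℝ) / i
      = ((harmonic n : ℚ) : ℝ) - ((harmonic m : ℚ) : ℝ) := by
    intro m n hmn
    rw [hH, hH]
    have := Finset.sum_Ioc_consecutive (fun i : ℕ => (1 : ℝ) / i) (Nat.zero_le m) hmn
    linarith
  have e : ∑ y ∈ Finset.Ioc Y (Y ^ 2), ∑ i ∈ Finset.Ioc 1 Y, (1 : ℝ) / (y * i)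
      = (∑ y ∈ Finset.Ioc Y (Y ^ 2), (1 : ℝ) / y) * ∑ i ∈ Finset.Ioc 1 Y, (1 : ℝ) / i := by
    rw [Finset.sum_mul_sum]
    refine Finset.sum_congr rfl fun y _ => Finset.sum_congr rfl fun i _ => ?_
    rw [one_div_mul_one_div]
  rw [e, split _ _ (Nat.le_self_pow (by norm_num) _), split _ _ hY1]
  have l1 := log_add_one_le_harmonic (Y ^ 2)
  have l2 := log_add_one_le_harmonic Y
  have l3 := harmonic_le_one_add_log Y
  have hYr : (1 : ℝ) ≤ Y := by exact_mod_cast hY1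
  have l4 : 2 * Real.log Y ≤ Real.log (((Y ^ 2 : ℕ) : ℝ) + 1) := by
    have : 2 * Real.log Y = Real.log ((Y : ℝ) ^ 2) := by rw [Real.log_pow]; norm_num
    rw [this]
    apply Real.log_le_log (by positivity)
    push_cast; linarith
  have l5 : Real.log Y ≤ Real.log ((Y : ℝ) + 1) := Real.log_le_log (by linarith) (by linarith)
  have l6 : ((harmonic 1 : ℚ) : ℝ) = 1 := by simp [harmonic]
  push_cast at l1 l2 l4
  rw [l6]
  have A : Real.log Y / 2 ≤ (harmonic (Y ^ 2) : ℝ) - (harmonic Y : ℝ) := by linarith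
  have B : Real.log Y / 2 ≤ (harmonic Y : ℝ) - 1 := by linarith
  calc _ = (Real.log Y / 2) * (Real.log Y / 2) := by ring
    _ ≤ _ := by apply mul_le_mul A B <;> linarith

lemma Ut_sum (t : ℝ) (h1 : 1 ≤ t) (h2 : t ≤ 2) (Y : ℕ) (hY : 2 ≤ Real.log Y) :
    (Real.log Y) ^ 2 / 8 ≤ ∑ u ∈ Ut t (Y ^ 2), 1 / max 1 ((u.2 : ℝ) * (u.1 - u.2 * t)) := by
  classical
  have hp := pair_sum Y hY
  set T := (Finset.Ioc Y (Y ^ 2)) ×ˢ (Finset.Ioc 1 Y) with hT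
  rw [← Finset.sum_product'] at hp
  set xx : ℕ × ℕ → ℕ := fun v => ⌊(v.1 : ℝ) * t⌋₊ + v.2 with hxx
  set φ : ℕ × ℕ → ℕ × ℕ := fun v => (xx v / Nat.gcd (xx v) v.1, v.1 / Nat.gcd (xx v) v.1) with hφ
  have hv : ∀ v ∈ T, Y < v.1 ∧ v.1 ≤ Y ^ 2 ∧ 1 < v.2 ∧ v.2 ≤ Y ∧ 1 ≤ (xx v : ℝ) - v.1 * t ∧
      (xx v : ℝ) - v.1 * t ≤ v.2 := by
    intro v hv
    simp only [hT, Finset.mem_product, Finset.mem_Ioc] at hv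
    refine ⟨hv.1.1, hv.1.2, hv.2.1, hv.2.2, ?_, ?_⟩
    · have := Nat.lt_floor_add_one ((v.1 : ℝ) * t)
      have h2 : (2 : ℝ) ≤ v.2 := by exact_mod_cast hv.2.1
      simp only [hxx]; push_cast; linarith
    · have := Nat.floor_le (show 0 ≤ (v.1 : ℝ) * t by positivity)
      simp only [hxx]; push_cast; linarith
  have hg : ∀ v ∈ T, 1 ≤ Nat.gcd (xx v) v.1 ∧ xx v = Nat.gcd (xx v) v.1 * (φ v).1 ∧
      v.1 = Nat.gcd (xx v) v.1 * (φ v).2 := by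
    intro v hvT
    obtain ⟨a1, -⟩ := hv v hvT
    refine ⟨Nat.gcd_pos_of_pos_right _ (by omega), ?_, ?_⟩
    · exact (Nat.mul_div_cancel' (Nat.gcd_dvd_left _ _)).symm
    · exact (Nat.mul_div_cancel' (Nat.gcd_dvd_right _ _)).symm
  have hmap : ∀ v ∈ T, φ v ∈ Ut t (Y ^ 2) := by
    intro v hvT
    obtain ⟨a1, a2, a3, a4, a5, a6⟩ := hv v hvT
    obtain ⟨g1, g2, g3⟩ := hg v hvT
    set g := Nat.gcd (xx v) v.1 with hgdef
    have gpos : (0 : ℝ) < g := by exact_mod_cast g1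
    have r2 : (xx v : ℝ) = g * (φ v).1 := by exact_mod_cast g2
    have r3 : (v.1 : ℝ) = g * (φ v).2 := by exact_mod_cast g3
    have b1 : (v.2 : ℝ) ≤ v.1 := by exact_mod_cast (a4.trans a1.le)
    have c1 : t * (φ v).2 < (φ v).1 := by
      have : (0 : ℝ) < g * ((φ v).1 - t * (φ v).2) := by rw [r2, r3] at a5; nlinarith
      have := (mul_pos_iff_of_pos_left gpos).1 this
      linarith
    have c2 : ((φ v).1 : ℝ) ≤ t * (φ v).2 + (φ v).2 := by
      have : (0 : ℝ) ≤ g * (t * (φ v).2 + (φ v).2 - (φ v).1) := by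
        have : (xx v : ℝ) - v.1 * t ≤ v.1 := a6.trans b1
        rw [r2, r3] at this; nlinarith
      have := nonneg_of_mul_nonneg_right this gpos
      linarith
    have y1 : 1 ≤ (φ v).2 := by
      rcases Nat.eq_zero_or_pos (φ v).2 with h | h
      · rw [h] at g3; omega
      · exact h
    have y2 : (φ v).2 ≤ Y ^ 2 := (Nat.le_of_dvd (by omega) ⟨g, by rw [mul_comm]; exact g3⟩).trans a2
    have y1r : (1 : ℝ) ≤ (φ v).2 := by exact_mod_cast y1
    rw [mem_Ut]
    refine ⟨⟨?_, ?_⟩, ⟨y1, y2⟩, Nat.coprime_div_gcd_div_gcd g1, c1, c2⟩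
    · have : (0 : ℝ) < (φ v).1 := by nlinarith
      exact_mod_cast this
    · have : ((φ v).1 : ℝ) ≤ 3 * (φ v).2 := by nlinarith
      have : (φ v).1 ≤ 3 * (φ v).2 := by exact_mod_cast this
      omega
  rw [← Finset.sum_fiberwise_of_maps_to hmap] at hp
  have key : ∀ u ∈ Ut t (Y ^ 2), ∑ v ∈ T with φ v = u, (1 : ℝ) / (v.1 * v.2)
      ≤ 2 * (1 / max 1 ((u.2 : ℝ) * (u.1 - u.2 * t))) := by
    intro u hu
    rw [mem_Ut] at hu
    obtain ⟨-, ⟨y1, -⟩, -, c1, c2⟩ := hu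
    set ξ : ℝ := u.1 - u.2 * t with hξ
    have hξ0 : 0 < ξ := by rw [hξ]; linarith
    have y1r : (1 : ℝ) ≤ u.2 := by exact_mod_cast y1
    set gg : ℕ × ℕ → ℕ := fun v => Nat.gcd (xx v) v.1 with hgg
    set F := T.filter (fun v => φ v = u) with hF
    have hFm : ∀ v ∈ F, v ∈ T ∧ 1 ≤ gg v ∧ xx v = gg v * u.1 ∧ v.1 = gg v * u.2 := by
      intro v hvF
      rw [hF, Finset.mem_filter] at hvF
      obtain ⟨g1, g2, g3⟩ := hg v hvF.1
      rw [hvF.2] at g2 g3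
      exact ⟨hvF.1, g1, g2, g3⟩
    have hinj : Set.InjOn gg F := by
      intro v hv w hw h
      obtain ⟨-, -, p1, p2⟩ := hFm v hv
      obtain ⟨-, -, q1, q2⟩ := hFm w hw
      have e1 : v.1 = w.1 := by rw [p2, q2, h]
      have e2 : xx v = xx w := by rw [p1, q1, h]
      have e3 : v.2 = w.2 := by
        simp only [hxx] at e2
        rw [e1] at e2; omega
      exact Prod.ext e1 e3
    have hxi : ∀ v ∈ F, (xx v : ℝ) - v.1 * t = gg v * ξ := by
      intro v hvF
      obtain ⟨f1, f2, f3, f4⟩ := hFm v hvF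
      have r3 : (xx v : ℝ) = gg v * u.1 := by exact_mod_cast f3
      have r4 : (v.1 : ℝ) = gg v * u.2 := by exact_mod_cast f4
      rw [r3, r4, hξ]; ring
    have s1 : ∑ v ∈ F, (1 : ℝ) / (v.1 * v.2) ≤ ∑ v ∈ F, (1 / (u.2 * ξ)) * (((gg v : ℕ) : ℝ) ^ 2)⁻¹ := by
      apply Finset.sum_le_sum
      intro v hvF
      obtain ⟨f1, f2, f3, f4⟩ := hFm v hvF
      obtain ⟨a1, a2, a3, a4, a5, a6⟩ := hv v f1
      rw [hxi v hvF] at a5 a6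
      have r4 : (v.1 : ℝ) = gg v * u.2 := by exact_mod_cast f4
      have gpos : (0 : ℝ) < gg v := by exact_mod_cast f2
      calc (1 : ℝ) / (v.1 * v.2) ≤ 1 / (v.1 * (gg v * ξ)) := by
            apply one_div_le_one_div_of_le
            · rw [r4]; positivity
            · gcongr
        _ = _ := by rw [r4]; field_simp
    have s2 : ∑ v ∈ F, (((gg v : ℕ) : ℝ) ^ 2)⁻¹ ≤ 2 * min 1 ξ := by
      rw [← Finset.sum_image (f := fun g : ℕ => ((g : ℝ) ^ 2)⁻¹) hinj]
      apply tail_sq ξ hξ0 (Y ^ 2)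
      intro g hgm
      rw [Finset.mem_image] at hgm
      obtain ⟨v, hvF, rfl⟩ := hgm
      obtain ⟨f1, f2, f3, f4⟩ := hFm v hvF
      obtain ⟨a1, a2, a3, a4, a5, a6⟩ := hv v f1
      refine ⟨f2, ?_, ?_⟩
      · exact (Nat.le_of_dvd (by omega) ⟨_, f4⟩).trans a2
      · rw [← hxi v hvF]; exact a5
    refine s1.trans ?_
    rw [← Finset.mul_sum]
    have y0 : (0 : ℝ) < u.2 := by linarith
    have hpos : 0 < (u.2 : ℝ) * ξ := by positivity
    calc _ ≤ 1 / (u.2 * ξ) * (2 * min 1 ξ) := by gcongr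
      _ = 2 * (min 1 ξ / (u.2 * ξ)) := by ring
      _ ≤ _ := by
        gcongr 2 * ?_
        rw [div_le_div_iff₀ hpos (by positivity), one_mul]
        rcases le_total 1 ((u.2 : ℝ) * ξ) with h | h
        · rw [max_eq_right h]
          nlinarith [min_le_left 1 ξ]
        · rw [max_eq_left h]
          nlinarith [min_le_right 1 ξ]
  have := hp.trans (Finset.sum_le_sum key)
  rw [← Finset.mul_sum] at this
  linarith

lemma moment_abs {Ω ι : Type*} [DecidableEq ι] (Γ : Finset Ω) (I I0 : Finset ι) (hI0 : I0 ⊆ I)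
    (s : ι → ℝ) (e : ι → Ω → ℂ) (r : Ω → ℝ) (η : ℝ) (hη : 0 ≤ η)
    (hs : ∀ i ∈ I0, 0 ≤ s i) (hr : ∀ γ ∈ Γ, ∑ i ∈ I, (s i : ℂ) * e i γ = r γ)
    (hn : ∀ i γ, ‖e i γ‖ = 1)
    (he : ∀ i ∈ I0, ∀ γ, e i γ = 1)
    (h1 : ∀ i ∈ I, i ∉ I0 → ‖∑ γ ∈ Γ, e i γ‖ ≤ η * Γ.card)
    (h2 : ∀ i ∈ I, ∀ j ∈ I, i ≠ j → ¬ (i ∈ I0 ∧ j ∈ I0) →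
      ‖∑ γ ∈ Γ, e i γ * (starRingEnd ℂ) (e j γ)‖ ≤ η * Γ.card)
    (hZ : η * ∑ i ∈ I, |s i| ≤ ∑ i ∈ I0, s i) :
    Γ.card * (∑ i ∈ I0, s i - η * ∑ i ∈ I, |s i|) ^ 2 ≤
      (Γ.filter (fun γ => 0 < r γ)).card *
        ((∑ i ∈ I0, s i) ^ 2 + ∑ i ∈ I, s i ^ 2 + η * (∑ i ∈ I, |s i|) ^ 2) := by
  classical
  set n : ℝ := ((Γ.card : ℕ) : ℝ) with hnd
  have hn0 : 0 ≤ n := by positivity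
  set Z0 := ∑ i ∈ I0, s i with hZ0
  set S1 := ∑ i ∈ I, |s i| with hS1
  have hS10 : 0 ≤ S1 := Finset.sum_nonneg fun _ _ => abs_nonneg _
  -- first moment
  have m1 : n * (Z0 - η * S1) ≤ ∑ γ ∈ Γ, r γ := by
    have eq : ((∑ γ ∈ Γ, r γ : ℝ) : ℂ) - (n * Z0 : ℝ)
        = ∑ i ∈ I \ I0, (s i : ℂ) * ∑ γ ∈ Γ, e i γ := by
      have : ((∑ γ ∈ Γ, r γ : ℝ) : ℂ) = ∑ i ∈ I, (s i : ℂ) * ∑ γ ∈ Γ, e i γ := by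
        push_cast
        rw [← Finset.sum_congr rfl hr, Finset.sum_comm]
        simp only [Finset.mul_sum]
      rw [this, ← Finset.sum_sdiff hI0]
      have : ∑ i ∈ I0, (s i : ℂ) * ∑ γ ∈ Γ, e i γ = (n * Z0 : ℝ) := by
        rw [hZ0]
        push_cast
        rw [Finset.mul_sum]
        refine Finset.sum_congr rfl fun i hi => ?_
        rw [Finset.sum_congr rfl fun γ _ => he i hi γ]
        simp [hnd, mul_comm]
      rw [this]; ring
    have b : ‖((∑ γ ∈ Γ, r γ : ℝ) : ℂ) - (n * Z0 : ℝ)‖ ≤ n * (η * S1) := by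
      rw [eq]
      calc _ ≤ ∑ i ∈ I \ I0, |s i| * (η * n) := by
            refine norm_sum_le_of_le _ fun i hi => ?_
            rw [Finset.mem_sdiff] at hi
            rw [norm_mul, Complex.norm_real, Real.norm_eq_abs]
            gcongr
            exact h1 i hi.1 hi.2
        _ ≤ ∑ i ∈ I, |s i| * (η * n) := by
            apply Finset.sum_le_sum_of_subset_of_nonneg Finset.sdiff_subset
            intros; positivity
        _ = _ := by rw [← Finset.sum_mul]; ring
    rw [← Complex.ofReal_sub, Complex.norm_real, Real.norm_eq_abs] at b
    have := (abs_le.1 b).1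
    linarith
  -- second moment
  have m2 : ∑ γ ∈ Γ, r γ ^ 2 ≤ n * (Z0 ^ 2 + ∑ i ∈ I, s i ^ 2 + η * S1 ^ 2) := by
    have eq : ((∑ γ ∈ Γ, r γ ^ 2 : ℝ) : ℂ)
        = ∑ i ∈ I, ∑ j ∈ I, (s i : ℂ) * s j * ∑ γ ∈ Γ, e i γ * (starRingEnd ℂ) (e j γ) := by
      push_cast
      have : ∀ γ ∈ Γ, ((r γ : ℂ)) ^ 2
          = ∑ i ∈ I, ∑ j ∈ I, (s i : ℂ) * s j * (e i γ * (starRingEnd ℂ) (e j γ)) := by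
        intro γ hγ
        have c : (r γ : ℂ) = (starRingEnd ℂ) (r γ : ℂ) := (Complex.conj_ofReal _).symm
        rw [sq]
        nth_rewrite 2 [c]
        rw [← hr γ hγ, map_sum, Finset.sum_mul_sum]
        refine Finset.sum_congr rfl fun i _ => Finset.sum_congr rfl fun j _ => ?_
        rw [map_mul, Complex.conj_ofReal]; ring
      rw [Finset.sum_congr rfl this, Finset.sum_comm]
      refine Finset.sum_congr rfl fun i _ => ?_
      rw [Finset.sum_comm]
      simp only [Finset.mul_sum]
    have b : ‖((∑ γ ∈ Γ, r γ ^ 2 : ℝ) : ℂ)‖ ≤ ∑ i ∈ I, ∑ j ∈ I, |s i| * |s j| *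
        ((if i ∈ I0 ∧ j ∈ I0 then n else 0) + (if i = j then n else 0) + η * n) := by
      rw [eq]
      refine norm_sum_le_of_le _ fun i hi => norm_sum_le_of_le _ fun j hj => ?_
      rw [norm_mul, norm_mul, Complex.norm_real, Complex.norm_real, Real.norm_eq_abs, Real.norm_eq_abs]
      gcongr
      have triv : ‖∑ γ ∈ Γ, e i γ * (starRingEnd ℂ) (e j γ)‖ ≤ n := by
        have : ‖∑ γ ∈ Γ, e i γ * (starRingEnd ℂ) (e j γ)‖ ≤ ∑ γ ∈ Γ, (1 : ℝ) := by
          refine norm_sum_le_of_le _ fun γ _ => ?_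
          rw [norm_mul, RCLike.norm_conj, hn, hn, mul_one]
        simpa [hnd] using this
      have p : 0 ≤ η * n := by positivity
      by_cases q1 : i ∈ I0 ∧ j ∈ I0
      · rw [if_pos q1]; split_ifs <;> linarith
      · by_cases q2 : i = j
        · rw [if_neg q1, if_pos q2]; linarith
        · rw [if_neg q1, if_neg q2]; linarith [h2 i hi j hj q2 q1]
    rw [Complex.norm_real, Real.norm_eq_abs] at b
    refine (le_abs_self _).trans (b.trans (le_of_eq ?_))
    simp only [mul_add, Finset.sum_add_distrib]
    have t1 : ∑ i ∈ I, ∑ j ∈ I, |s i| * |s j| * (if i ∈ I0 ∧ j ∈ I0 then n else 0) = n * Z0 ^ 2 := by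
      have : ∀ i j, |s i| * |s j| * (if i ∈ I0 ∧ j ∈ I0 then n else 0)
          = (if i ∈ I0 then s i else 0) * ((if j ∈ I0 then s j else 0) * n) := by
        intro i j
        by_cases q1 : i ∈ I0 <;> by_cases q2 : j ∈ I0 <;> simp [q1, q2]
        rw [abs_of_nonneg (hs i q1), abs_of_nonneg (hs j q2)]; ring
      simp only [this]
      rw [← Finset.sum_mul_sum, ← Finset.sum_mul, Finset.sum_ite_mem, Finset.inter_eq_right.2 hI0]
      ring
    have t2 : ∑ i ∈ I, ∑ j ∈ I, |s i| * |s j| * (if i = j then n else 0) = n * ∑ i ∈ I, s i ^ 2 := by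
      rw [Finset.mul_sum]
      refine Finset.sum_congr rfl fun i hi => ?_
      simp only [mul_ite, mul_zero]
      rw [Finset.sum_ite_eq, if_pos hi, ← abs_mul, ← sq, abs_of_nonneg (sq_nonneg _)]; ring
    have t3 : ∑ i ∈ I, ∑ j ∈ I, |s i| * |s j| * (η * n) = n * (η * S1 ^ 2) := by
      simp only [← Finset.sum_mul, ← Finset.mul_sum]
      rw [← hS1]; ring
    rw [t1, t2, t3]
  set P := Γ.filter (fun γ => 0 < r γ) with hP
  have m3 : ∑ γ ∈ Γ, r γ ≤ ∑ γ ∈ P, r γ := by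
    rw [hP, ← Finset.sum_filter_add_sum_filter_not Γ (fun γ => 0 < r γ)]
    have : ∑ γ ∈ Γ with ¬ 0 < r γ, r γ ≤ 0 :=
      Finset.sum_nonpos fun γ hγ => not_lt.1 (Finset.mem_filter.1 hγ).2
    linarith
  have m4 : (∑ γ ∈ P, r γ) ^ 2 ≤ P.card * ∑ γ ∈ P, r γ ^ 2 := sq_sum_le_card_mul_sum_sq
  have m5 : ∑ γ ∈ P, r γ ^ 2 ≤ ∑ γ ∈ Γ, r γ ^ 2 :=
    Finset.sum_le_sum_of_subset_of_nonneg (Finset.filter_subset _ _) fun _ _ _ => sq_nonneg _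
  rcases hn0.eq_or_lt with h0 | h0
  · rw [← h0, zero_mul]
    have : 0 ≤ ∑ i ∈ I, s i ^ 2 := Finset.sum_nonneg fun _ _ => sq_nonneg _
    positivity
  have c0 : 0 ≤ n * (Z0 - η * S1) := mul_nonneg hn0 (by linarith)
  have c1 : (n * (Z0 - η * S1)) ^ 2 ≤ P.card * (n * (Z0 ^ 2 + ∑ i ∈ I, s i ^ 2 + η * S1 ^ 2)) := by
    calc _ ≤ (∑ γ ∈ P, r γ) ^ 2 := by
          apply pow_le_pow_left₀ c0; linarith
      _ ≤ _ := m4.trans (by gcongr; linarith)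
  have c2 : n * (n * (Z0 - η * S1) ^ 2)
      ≤ n * (P.card * (Z0 ^ 2 + ∑ i ∈ I, s i ^ 2 + η * S1 ^ 2)) := by nlinarith
  exact le_of_mul_le_mul_left c2 h0

lemma prim_freq (x y x' y' : ℕ) (h : Nat.Coprime x y) (h' : Nat.Coprime x' y') (hx : 1 ≤ x)
    (hx' : 1 ≤ x') (k k' : ℤ) (e1 : k * x = k' * x') (e2 : k * y = k' * y') :
    (k = 0 ∧ k' = 0) ∨ (k = k' ∧ x = x' ∧ y = y') := by
  have hxz : (0 : ℤ) < x := by exact_mod_cast hx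
  have hxz' : (0 : ℤ) < x' := by exact_mod_cast hx'
  by_cases hk : k = 0
  · left
    refine ⟨hk, ?_⟩
    rw [hk, zero_mul] at e1
    rcases mul_eq_zero.1 e1.symm with h | h
    · exact h
    · omega
  · right
    have g1 : Int.gcd (k * x) (k * y) = k.natAbs := by
      rw [Int.gcd_mul_left]
      have : Int.gcd (x : ℤ) (y : ℤ) = 1 := by simpa [Int.gcd_natCast_natCast] using h
      rw [this, mul_one]
    have g2 : Int.gcd (k' * x') (k' * y') = k'.natAbs := by
      rw [Int.gcd_mul_left]
      have : Int.gcd (x' : ℤ) (y' : ℤ) = 1 := by simpa [Int.gcd_natCast_natCast] using h'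
      rw [this, mul_one]
    have g3 : k.natAbs = k'.natAbs := by rw [← g1, ← g2, e1, e2]
    have hkk : k = k' := by
      rcases Int.natAbs_eq_natAbs_iff.1 g3 with h | h
      · exact h
      · exfalso
        rw [h] at e1
        have : k' * ((x : ℤ) + x') = 0 := by linarith
        rcases mul_eq_zero.1 this with h0 | h0
        · apply hk; rw [h, h0]; rfl
        · omega
    subst hkk
    refine ⟨rfl, ?_, ?_⟩
    · exact_mod_cast mul_left_cancel₀ hk e1
    · exact_mod_cast mul_left_cancel₀ hk e2

theorem second_moment {Ω : Type*} [DecidableEq Ω] (Γ : Finset Ω) (χ1 χ2 : Ω → ℝ)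
    (U : Finset (ℕ × ℕ)) (m : ℕ × ℕ → ℕ) (η : ℝ) (hη0 : 0 ≤ η) (X M : ℕ)
    (hU : ∀ u ∈ U, Nat.Coprime u.1 u.2 ∧ 1 ≤ u.1 ∧ u.1 ≤ 3 * X ∧ 1 ≤ u.2 ∧ u.2 ≤ X)
    (hm : ∀ u ∈ U, 1 ≤ m u ∧ m u ≤ X ^ 3) (hM : 12 * X ^ 4 ≤ M)
    (hη : ∀ f1 f2 : ℤ, |f1| ≤ M → |f2| ≤ M → ¬ (f1 = 0 ∧ f2 = 0) →
      ‖∑ γ ∈ Γ, ef (f1 * χ1 γ + f2 * χ2 γ)‖ ≤ η * Γ.card)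
    (z : ℝ) (hz : z = ∑ u ∈ U, 1 / (m u : ℝ)) (hz0 : 0 < z)
    (hη1 : η * (100 * U.card) ≤ z / 2) (hη2 : η * (100 * U.card) ^ 2 ≤ z)
    (P : Finset Ω) (hP : ∀ γ ∈ Γ, (∃ u ∈ U, distNearestInt (u.1 * χ1 γ + u.2 * χ2 γ) < 1 / m u) → γ ∈ P) :
    Γ.card * (z / (4 * (z + 2001))) ≤ (P.card : ℝ) := by
  classical
  have hker : ∀ u : ℕ × ℕ, ∃ g : ℤ → ℝ, u ∈ U → (1 / (m u : ℝ) ≤ g 0 ∧ (∀ k, |g k| ≤ 20 / m u) ∧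
      ∀ x : ℝ, ∃ r : ℝ, ∑ k ∈ Finset.Icc (-(2 * m u : ℤ)) (2 * m u), (g k : ℂ) * ef (k * x) = r ∧
        (0 < r → distNearestInt x < 1 / m u)) := by
    intro u
    by_cases hu : u ∈ U
    · obtain ⟨g, hg⟩ := kernel_exists (m u) (hm u hu).1
      exact ⟨g, fun _ => hg⟩
    · exact ⟨0, fun h => absurd h hu⟩
  choose g hg using hker
  have hr : ∀ (u : ℕ × ℕ) (x : ℝ), ∃ r : ℝ, u ∈ U →
      ∑ k ∈ Finset.Icc (-(2 * m u : ℤ)) (2 * m u), (g u k : ℂ) * ef (k * x) = r ∧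
        (0 < r → distNearestInt x < 1 / m u) := by
    intro u x
    by_cases hu : u ∈ U
    · obtain ⟨r, hr⟩ := (hg u hu).2.2 x
      exact ⟨r, fun _ => hr⟩
    · exact ⟨0, fun h => absurd h hu⟩
  choose r hr using hr
  set I : Finset (Sigma (fun _ : ℕ × ℕ => ℤ)) :=
    U.sigma (fun u => Finset.Icc (-(2 * m u : ℤ)) (2 * m u)) with hI
  set I0 := I.filter (fun i => i.2 = 0) with hI0
  have mp : ∀ u ∈ U, (1 : ℝ) ≤ m u := fun u hu => by exact_mod_cast (hm u hu).1
  have hcard : ∀ u, ((Finset.Icc (-(2 * m u : ℤ)) (2 * m u)).card : ℝ) = 4 * m u + 1 := by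
    intro u
    have := card_sym (2 * m u)
    push_cast at this
    rw [this]; push_cast; ring
  have sumI0 : ∑ i ∈ I0, g i.1 i.2 = ∑ u ∈ U, g u 0 := by
    rw [hI0, Finset.sum_filter, hI, Finset.sum_sigma]
    refine Finset.sum_congr rfl fun u hu => ?_
    rw [Finset.sum_ite_eq' (Finset.Icc (-(2 * m u : ℤ)) (2 * m u)) 0 (fun k => g u k), if_pos]
    simp
  have sumI1 : ∑ i ∈ I, |g i.1 i.2| ≤ 100 * U.card := by
    rw [hI, Finset.sum_sigma]
    calc _ ≤ ∑ u ∈ U, (100 : ℝ) := by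
          apply Finset.sum_le_sum
          intro u hu
          have h1 := mp u hu
          calc _ ≤ ∑ k ∈ Finset.Icc (-(2 * m u : ℤ)) (2 * m u), (20 / m u : ℝ) :=
                Finset.sum_le_sum fun k _ => (hg u hu).2.1 k
            _ = (4 * m u + 1) * (20 / m u) := by rw [Finset.sum_const, nsmul_eq_mul, hcard]
            _ ≤ 100 := by
              rw [← mul_div_assoc, div_le_iff₀ (by linarith)]; linarith
      _ = _ := by rw [Finset.sum_const, nsmul_eq_mul]; ring
  have sumI2 : ∑ i ∈ I, (g i.1 i.2) ^ 2 ≤ 2000 * z := by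
    rw [hI, Finset.sum_sigma, hz, Finset.mul_sum]
    apply Finset.sum_le_sum
    intro u hu
    have h1 := mp u hu
    calc _ ≤ ∑ k ∈ Finset.Icc (-(2 * m u : ℤ)) (2 * m u), (20 / m u : ℝ) ^ 2 :=
          Finset.sum_le_sum fun k _ => by
            rw [← sq_abs]
            exact pow_le_pow_left₀ (abs_nonneg _) ((hg u hu).2.1 k) 2
      _ = (4 * m u + 1) * (20 / m u) ^ 2 := by rw [Finset.sum_const, nsmul_eq_mul, hcard]
      _ = (4 * m u + 1) * 400 / (m u) ^ 2 := by rw [div_pow]; ring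
      _ ≤ (5 * m u) * 400 / (m u) ^ 2 := by gcongr; linarith
      _ = _ := by field_simp; norm_num
  set Z0 := ∑ i ∈ I0, g i.1 i.2 with hZ0
  have zZ : z ≤ Z0 := by
    rw [sumI0, hz]
    exact Finset.sum_le_sum fun u hu => (hg u hu).1
  set S1 := ∑ i ∈ I, |g i.1 i.2| with hS1
  have S10 : 0 ≤ S1 := Finset.sum_nonneg fun _ _ => abs_nonneg _
  have ηS : η * S1 ≤ z / 2 := (mul_le_mul_of_nonneg_left sumI1 hη0).trans hη1
  have ηS2 : η * S1 ^ 2 ≤ z :=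
    (mul_le_mul_of_nonneg_left (pow_le_pow_left₀ S10 sumI1 2) hη0).trans hη2
  have memI : ∀ i ∈ I, i.1 ∈ U ∧ |i.2| ≤ 2 * (X : ℤ) ^ 3 := by
    intro i hi
    rw [hI, Finset.mem_sigma, Finset.mem_Icc] at hi
    refine ⟨hi.1, ?_⟩
    have : ((m i.1 : ℕ) : ℤ) ≤ (X : ℤ) ^ 3 := by exact_mod_cast (hm _ hi.1).2
    rw [abs_le]; constructor <;> linarith [hi.2.1, hi.2.2]
  have hMz : 12 * (X : ℤ) ^ 4 ≤ M := by exact_mod_cast hM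
  have fb : ∀ i ∈ I, |i.2 * (i.1.1 : ℤ)| ≤ 6 * (X : ℤ) ^ 4 ∧ |i.2 * (i.1.2 : ℤ)| ≤ 6 * (X : ℤ) ^ 4 := by
    intro i hi
    obtain ⟨a1, a2⟩ := memI i hi
    obtain ⟨-, b1, b2, b3, b4⟩ := hU _ a1
    have b2' : ((i.1.1 : ℕ) : ℤ) ≤ 3 * X := by exact_mod_cast b2
    have b4' : ((i.1.2 : ℕ) : ℤ) ≤ X := by exact_mod_cast b4
    constructor
    · rw [abs_mul, Nat.abs_cast]
      calc _ ≤ 2 * (X : ℤ) ^ 3 * (3 * X) := by gcongr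
        _ = _ := by ring
    · rw [abs_mul, Nat.abs_cast]
      calc _ ≤ 2 * (X : ℤ) ^ 3 * (X) := by gcongr
        _ ≤ _ := by nlinarith [pow_nonneg (Int.natCast_nonneg X) 4]
  have X4 : 0 ≤ (X : ℤ) ^ 4 := by positivity
  have main := moment_abs Γ I I0 (Finset.filter_subset _ _) (fun i => g i.1 i.2)
    (fun i γ => ef (i.2 * (i.1.1 * χ1 γ + i.1.2 * χ2 γ)))
    (fun γ => ∑ u ∈ U, r u (u.1 * χ1 γ + u.2 * χ2 γ)) η hη0
    (by
      intro i hi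
      rw [hI0, Finset.mem_filter] at hi
      rw [hi.2]
      exact le_trans (by positivity) (hg _ (memI i hi.1).1).1)
    (by
      intro γ _
      rw [hI, Finset.sum_sigma]
      push_cast
      exact Finset.sum_congr rfl fun u hu => (hr u _ hu).1)
    (fun i γ => ef_norm _)
    (by
      intro i hi γ
      rw [hI0, Finset.mem_filter] at hi
      rw [hi.2]; simp [ef_zero])
    (by
      intro i hi hi0
      have : i.2 ≠ 0 := fun h => hi0 (by rw [hI0, Finset.mem_filter]; exact ⟨hi, h⟩)
      have hx := (hU _ (memI i hi).1).2.1
      have := hη (i.2 * i.1.1) (i.2 * i.1.2) (by linarith [(fb i hi).1]) (by linarith [(fb i hi).2])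
        (by
          rintro ⟨h, -⟩
          rcases mul_eq_zero.1 h with h | h
          · exact this h
          · have : i.1.1 = 0 := by exact_mod_cast h
            omega)
      convert this using 5
      push_cast; ring)
    (by
      intro i hi j hj hij h0
      obtain ⟨c1, d1, -, -, -⟩ := hU _ (memI i hi).1
      obtain ⟨c2, d2, -, -, -⟩ := hU _ (memI j hj).1
      have := hη (i.2 * i.1.1 - j.2 * j.1.1) (i.2 * i.1.2 - j.2 * j.1.2)
        ((abs_sub _ _).trans (by linarith [(fb i hi).1, (fb j hj).1]))
        ((abs_sub _ _).trans (by linarith [(fb i hi).2, (fb j hj).2]))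
        (by
          rintro ⟨h, h'⟩
          rcases prim_freq _ _ _ _ c1 c2 d1 d2 _ _ (sub_eq_zero.1 h) (sub_eq_zero.1 h') with q | q
          · apply h0
            rw [hI0, Finset.mem_filter, Finset.mem_filter]
            exact ⟨⟨hi, q.1⟩, hj, q.2⟩
          · apply hij
            obtain ⟨⟨x, y⟩, k⟩ := i
            obtain ⟨⟨x', y'⟩, k'⟩ := j
            simp only at q
            obtain ⟨rfl, rfl, rfl⟩ := q
            rfl)
      convert this using 5
      rw [ef_conj_mul]
      congr 1
      push_cast; ring)
    (by linarith)
  simp only [← hZ0, ← hS1] at main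
  set F := Γ.filter (fun γ => 0 < ∑ u ∈ U, r u (u.1 * χ1 γ + u.2 * χ2 γ)) with hF
  have hFP : F.card ≤ P.card := by
    apply Finset.card_le_card
    intro γ hγ
    rw [hF, Finset.mem_filter] at hγ
    apply hP γ hγ.1
    obtain ⟨u, hu, hpos⟩ := Finset.exists_lt_of_sum_lt (s := U) (f := fun _ => (0 : ℝ))
      (g := fun u => r u (u.1 * χ1 γ + u.2 * χ2 γ)) (by simpa using hγ.2)
    exact ⟨u, hu, (hr u _ hu).2 hpos⟩
  have hFP' : (F.card : ℝ) ≤ P.card := by exact_mod_cast hFP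
  refine le_trans ?_ hFP'
  have n0 : (0 : ℝ) ≤ Γ.card := by positivity
  have f0 : (0 : ℝ) ≤ F.card := by positivity
  have e1 : (Γ.card : ℝ) * (Z0 / 2) ^ 2 ≤ F.card * (Z0 ^ 2 + 2001 * z) := by
    refine le_trans ?_ (main.trans ?_)
    · apply mul_le_mul_of_nonneg_left _ n0
      apply pow_le_pow_left₀ (by linarith) (by linarith)
    · apply mul_le_mul_of_nonneg_left _ f0
      linarith
  have den : 0 < Z0 ^ 2 + 2001 * z := by positivity
  have e2 : (Γ.card : ℝ) * ((Z0 / 2) ^ 2 / (Z0 ^ 2 + 2001 * z)) ≤ F.card := by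
    rw [← mul_div_assoc, div_le_iff₀ den]; exact e1
  refine le_trans (mul_le_mul_of_nonneg_left ?_ n0) e2
  rw [div_le_div_iff₀ (by positivity) den]
  have hz2 : z ^ 2 ≤ Z0 ^ 2 := pow_le_pow_left₀ hz0.le zZ 2
  nlinarith

def mw (A : ℝ) (X : ℕ) (t : ℝ) (u : ℕ × ℕ) : ℕ :=
  ⌈A * (Real.log X) ^ 2 * max 1 ((u.2 : ℝ) * (u.1 - u.2 * t))⌉₊

lemma mw_bounds (A : ℝ) (hA : 1 ≤ A) (X : ℕ) (hX : 1 ≤ Real.log X) (h2 : 2 * A * (Real.log X) ^ 2 ≤ X)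
    (t : ℝ) (u : ℕ × ℕ) (hu : u ∈ Ut t X) :
    1 ≤ mw A X t u ∧ mw A X t u ≤ X ^ 3 ∧
    A * (Real.log X) ^ 2 * max 1 ((u.2 : ℝ) * (u.1 - u.2 * t)) ≤ mw A X t u ∧
    (mw A X t u : ℝ) ≤ 2 * A * (Real.log X) ^ 2 * max 1 ((u.2 : ℝ) * (u.1 - u.2 * t)) := by
  rw [mem_Ut] at hu
  obtain ⟨-, ⟨y1, y2⟩, -, c1, c2⟩ := hu
  have hl : 1 ≤ (Real.log X) ^ 2 := one_le_pow₀ hX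
  have hAl : 1 ≤ A * (Real.log X) ^ 2 := by nlinarith
  have hX1 : 1 ≤ X := y1.trans y2
  have hXr : (1 : ℝ) ≤ X := by exact_mod_cast hX1
  have y2r : (u.2 : ℝ) ≤ X := by exact_mod_cast y2
  have y1r : (1 : ℝ) ≤ u.2 := by exact_mod_cast y1
  set v := max 1 ((u.2 : ℝ) * (u.1 - u.2 * t)) with hv
  have v1 : 1 ≤ v := le_max_left _ _
  have v2 : v ≤ (X : ℝ) ^ 2 := by
    apply max_le (one_le_pow₀ hXr)
    rw [sq]
    apply mul_le_mul y2r (by linarith) (by linarith) (by linarith)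
  have w1 : 1 ≤ A * (Real.log X) ^ 2 * v := by nlinarith
  have k1 : A * (Real.log X) ^ 2 * v ≤ mw A X t u := Nat.le_ceil _
  have k2 : (mw A X t u : ℝ) ≤ 2 * A * (Real.log X) ^ 2 * v := by
    have : (mw A X t u : ℝ) < A * (Real.log X) ^ 2 * v + 1 := Nat.ceil_lt_add_one (by linarith)
    linarith
  refine ⟨?_, ?_, k1, k2⟩
  · have : (1 : ℝ) ≤ mw A X t u := w1.trans k1
    exact_mod_cast this
  · have : (mw A X t u : ℝ) ≤ (X : ℝ) ^ 3 := by
      calc _ ≤ _ := k2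
        _ ≤ X * (X : ℝ) ^ 2 := by gcongr
        _ = _ := by ring
    exact_mod_cast this

lemma mw_sum (A : ℝ) (hA : 1 ≤ A) (Y : ℕ) (hY : 2 ≤ Real.log Y) (X : ℕ) (hXY : X = Y ^ 2)
    (h2 : 2 * A * (Real.log X) ^ 2 ≤ X) (t : ℝ) (ht1 : 1 ≤ t) (ht2 : t ≤ 2) :
    1 / (64 * A) ≤ ∑ u ∈ Ut t X, 1 / (mw A X t u : ℝ) := by
  have hl : Real.log X = 2 * Real.log Y := by
    rw [hXY]; push_cast; rw [Real.log_pow]; norm_num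
  have hlX : 1 ≤ Real.log X := by linarith
  have hs := Ut_sum t ht1 ht2 Y hY
  rw [← hXY] at hs
  have : ∑ u ∈ Ut t X, 1 / (2 * A * (Real.log X) ^ 2) * (1 / max 1 ((u.2 : ℝ) * (u.1 - u.2 * t)))
      ≤ ∑ u ∈ Ut t X, 1 / (mw A X t u : ℝ) := by
    apply Finset.sum_le_sum
    intro u hu
    obtain ⟨m1, m2, m3, m4⟩ := mw_bounds A hA X hlX h2 t u hu
    rw [one_div_mul_one_div]
    apply one_div_le_one_div_of_le _ m4
    exact_mod_cast m1
  refine le_trans ?_ this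
  rw [← Finset.mul_sum]
  calc 1 / (64 * A) = 1 / (2 * A * (Real.log X) ^ 2) * ((Real.log Y) ^ 2 / 8) := by
        rw [hl]
        have : Real.log Y ≠ 0 := by linarith
        field_simp; norm_num
    _ ≤ _ := by gcongr

set_option maxHeartbeats 1000000 in
lemma geom (a b c d : ℝ) (N : ℕ) (g1 g2 : M2) (h1 : IsF c d N g1) (h2 : IsF 1 2 N g2) (t : ℝ)
    (ht1 : 1 ≤ t) (ht2 : t ≤ 2) (X : ℕ) (u : ℕ × ℕ) (hu : u ∈ Ut t X) :
    ∃ n : ℕ, N < 8 * n ∧ n ≤ 12 * X * N ^ 2 ∧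
      (n : ℝ) * distNearestInt (n * (g1.phi (g2.phi t))) ≤ 2 * ((u.2 : ℝ) * (u.1 - u.2 * t)) ∧
      distNearestInt (n * (a * (g1.phi (g2.phi t)) + b)) ≤
        distNearestInt (u.1 * (g2.p * Lf a b g1 + g2.q * Lf2 a b g1)
          + u.2 * (g2.r * Lf a b g1 + g2.s * Lf2 a b g1)) + |a| * (8 * X / N) := by
  rw [mem_Ut] at hu
  obtain ⟨⟨x1, x2⟩, ⟨y1, y2⟩, -, c1, c2⟩ := hu
  obtain ⟨b1, b2, b3, b4⟩ := IsF.bounds12 h2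
  have q1 := h1.q1
  have q2 := h2.q1
  have hs1 := h1.hs1
  have hs2 := h2.hs1
  have hq8 := h1.hq8
  have hqN1 := h1.hqN
  have hqN2 := h2.hqN
  have hsN1 := h1.hsN
  have hsN2 := h2.hsN
  have d1 := h1.det
  have d2 := h2.det
  obtain ⟨x, y⟩ := u
  simp only at x1 x2 y1 y2 c1 c2 ⊢
  obtain ⟨p1, q1', r1, s1⟩ := g1
  obtain ⟨p2, q2', r2, s2⟩ := g2
  simp only [M2.phi, Lf, Lf2] at *
  set qg : ℤ := q1' * p2 + s1 * q2' with hqg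
  set sg : ℤ := q1' * r2 + s1 * s2 with hsg
  set pg : ℤ := p1 * p2 + r1 * q2' with hpg
  set rg : ℤ := p1 * r2 + r1 * s2 with hrg
  have detg : pg * sg - rg * qg = 1 := by
    have : pg * sg - rg * qg = (p1 * s1 - r1 * q1') * (p2 * s2 - r2 * q2') := by
      rw [hpg, hqg, hrg, hsg]; ring
    rw [this, d1, d2]; norm_num
  have hN0 : (0 : ℤ) ≤ N := by positivity
  have qg1 : q1' ≤ qg := by nlinarith
  have sg1 : 1 ≤ sg := by nlinarith
  have qgN : qg ≤ 3 * (N : ℤ) ^ 2 := by nlinarith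
  have sgN : sg ≤ 3 * (N : ℤ) ^ 2 := by nlinarith
  have x1z : (1 : ℤ) ≤ x := by exact_mod_cast x1
  have y1z : (1 : ℤ) ≤ y := by exact_mod_cast y1
  have x2z : (x : ℤ) ≤ 3 * X := by exact_mod_cast x2
  have y2z : (y : ℤ) ≤ X := by exact_mod_cast y2
  have nq : qg ≤ x * qg + y * sg := by nlinarith
  have nn : 0 ≤ (x : ℤ) * qg + y * sg := by linarith
  obtain ⟨n, hn⟩ := Int.eq_ofNat_of_zero_le nn
  have hnr : (n : ℝ) = x * qg + y * sg := by exact_mod_cast hn.symm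
  have qgp : (0 : ℝ) < qg := by exact_mod_cast (by linarith : (0 : ℤ) < qg)
  have sgp : (0 : ℝ) < sg := by exact_mod_cast (by linarith : (0 : ℤ) < sg)
  have hden : 0 < (qg : ℝ) * t + sg := by positivity
  set P : ℤ := x * pg + y * rg with hP
  set ξ : ℝ := x - y * t with hξ
  have y1r : (1 : ℝ) ≤ y := by exact_mod_cast y1
  have y2r : (y : ℝ) ≤ X := by exact_mod_cast y2
  have ξ0 : 0 < ξ := by rw [hξ]; linarith
  have ξy : ξ ≤ y := by rw [hξ]; linarith
  have hden2 : 0 < (q2' : ℝ) * t + s2 := by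
    have : (1 : ℝ) ≤ q2' := by exact_mod_cast q2
    have : (1 : ℝ) ≤ s2 := by exact_mod_cast hs2
    positivity
  have hβ : ((p1 : ℝ) * ((p2 * t + r2) / (q2' * t + s2)) + r1) / (q1' * ((p2 * t + r2) / (q2' * t + s2)) + s1)
      = (pg * t + rg) / (qg * t + sg) := by
    have e1 : (p1 : ℝ) * ((p2 * t + r2) / (q2' * t + s2)) + r1 = (pg * t + rg) / (q2' * t + s2) := by
      rw [hpg, hrg]; push_cast; field_simp; ring
    have e2 : (q1' : ℝ) * ((p2 * t + r2) / (q2' * t + s2)) + s1 = (qg * t + sg) / (q2' * t + s2) := by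
      rw [hqg, hsg]; push_cast; field_simp; ring
    rw [e1, e2, div_div_div_cancel_right₀ hden2.ne']
  rw [hβ]
  set β : ℝ := (pg * t + rg) / (qg * t + sg) with hβd
  have dr : (pg : ℝ) * sg - rg * qg = 1 := by exact_mod_cast detg
  have hdiff : n * β - P = - (ξ / (qg * t + sg)) := by
    rw [hβd, hnr, hP, hξ]; push_cast
    rw [← neg_div, mul_div_assoc', eq_div_iff hden.ne', sub_mul, div_mul_cancel₀ _ hden.ne']
    linear_combination (-(x : ℝ) + y * t) * dr
  have hpos : 0 < ξ / ((qg : ℝ) * t + sg) := by positivity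
  have habs : |n * β - P| = ξ / (qg * t + sg) := by rw [hdiff, abs_neg, abs_of_pos hpos]
  have hqt : (qg : ℝ) ≤ qg * t + sg := by nlinarith
  refine ⟨n, ?_, ?_, ?_, ?_⟩
  · have hnz : (n : ℤ) = x * qg + y * sg := hn.symm
    zify; linarith
  · have hnz : (n : ℤ) = x * qg + y * sg := hn.symm
    zify; rw [hnz]
    calc (x : ℤ) * qg + y * sg ≤ (3 * X) * (3 * (N : ℤ) ^ 2) + X * (3 * (N : ℤ) ^ 2) := by gcongr
      _ = _ := by ring
  · have h1 : distNearestInt (n * β) ≤ ξ / (qg * t + sg) := (dni_le _ P).trans habs.le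
    have hn2 : (n : ℝ) = y * (qg * t + sg) + qg * ξ := by rw [hnr, hξ]; ring
    calc (n : ℝ) * distNearestInt (n * β) ≤ n * (ξ / (qg * t + sg)) := by gcongr
      _ = y * ξ + ξ ^ 2 * (qg / (qg * t + sg)) := by rw [hn2]; field_simp
      _ ≤ y * ξ + ξ ^ 2 * 1 := by
          gcongr
          rw [div_le_one hden]; exact hqt
      _ ≤ 2 * (y * ξ) := by
          have := mul_le_mul_of_nonneg_right ξy ξ0.le
          rw [mul_one, sq]; linarith
  · have e : n * (a * β + b) = (x * (p2 * (a * p1 + b * q1') + q2' * (a * r1 + b * s1))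
          + y * (r2 * (a * p1 + b * q1') + s2 * (a * r1 + b * s1))) + a * (n * β - P) := by
      have : (n : ℝ) * (a * β + b) = a * (n * β - P) + (a * P + b * n) := by ring
      rw [this, add_comm, hnr, hP, hpg, hrg, hqg, hsg]; push_cast; ring
    rw [e]
    refine (dni_add_le _ _).trans ?_
    gcongr _ + ?_
    rw [abs_mul, habs]
    apply mul_le_mul_of_nonneg_left _ (abs_nonneg a)
    have Nq : (N : ℝ) ≤ 8 * qg := by
      have : (N : ℤ) ≤ 8 * qg := by linarith
      exact_mod_cast this
    have Np : (0 : ℝ) < N := by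
      have : (1 : ℤ) ≤ N := by linarith
      exact_mod_cast this
    rw [div_le_div_iff₀ hden Np]
    have k1 : ξ ≤ X := ξy.trans y2r
    have k2 : (N : ℝ) ≤ 8 * (qg * t + sg) := by linarith
    calc ξ * N ≤ X * (8 * (qg * t + sg)) := by gcongr
      _ = _ := by ring

def Bgood (a b ε : ℝ) (N0 : ℕ) : Set ℝ :=
  {β | ∃ n : ℕ, N0 ≤ n ∧ (n : ℝ) * (Real.log n) ^ 2 * distNearestInt (n * (a * β + b)) *
    distNearestInt (n * β) < ε}

lemma good (a b c d ε A : ℝ) (hA : 1 ≤ A) (E : ℕ) (hAε : 4 * (2 * (E : ℝ) + 2) ^ 2 < A * ε)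
    (X N N0 : ℕ) (hX : 12 ≤ X) (hN : N = X ^ E) (hl : 1 ≤ Real.log X)
    (h2 : 2 * A * (Real.log X) ^ 2 ≤ X) (ha : 8 * |a| * (X : ℝ) ^ 4 ≤ N) (hN0 : 8 * N0 ≤ N)
    (g1 g2 : M2) (h1 : IsF c d N g1) (hg2 : IsF 1 2 N g2) (t : ℝ)
    (ht1 : 1 ≤ t) (ht2 : t ≤ 2) (u : ℕ × ℕ) (hu : u ∈ Ut t X)
    (hd : distNearestInt (u.1 * (g2.p * Lf a b g1 + g2.q * Lf2 a b g1)
          + u.2 * (g2.r * Lf a b g1 + g2.s * Lf2 a b g1)) < 1 / mw A X t u) :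
    g1.phi (g2.phi t) ∈ Bgood a b ε N0 := by
  obtain ⟨n, n1, n2, n3, n4⟩ := geom a b c d N g1 g2 h1 hg2 t ht1 ht2 X u hu
  obtain ⟨m1, m2, m3, m4⟩ := mw_bounds A hA X hl h2 t u hu
  refine ⟨n, by omega, ?_⟩
  set β := g1.phi (g2.phi t)
  set v := max 1 ((u.2 : ℝ) * (u.1 - u.2 * t)) with hv
  set m := mw A X t u
  have v1 : 1 ≤ v := le_max_left _ _
  have mr : (1 : ℝ) ≤ m := by exact_mod_cast m1
  have m2r : (m : ℝ) ≤ (X : ℝ) ^ 3 := by exact_mod_cast m2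
  have Xr : (12 : ℝ) ≤ X := by exact_mod_cast hX
  have Np : (0 : ℝ) < N := by rw [hN]; push_cast; positivity
  have na : distNearestInt (n * (a * β + b)) ≤ 2 / m := by
    have : |a| * (8 * X / N) ≤ 1 / m := by
      rw [← mul_div_assoc, div_le_div_iff₀ Np (by linarith)]
      calc |a| * (8 * X) * m ≤ |a| * (8 * X) * (X : ℝ) ^ 3 := by gcongr
        _ = 8 * |a| * (X : ℝ) ^ 4 := by ring
        _ ≤ _ := by linarith
    calc _ ≤ _ := n4
      _ ≤ 1 / m + 1 / m := by linarith
      _ = _ := by ring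
  have nb : (n : ℝ) * distNearestInt (n * β) ≤ 2 * v := n3.trans (by gcongr; exact le_max_right _ _)
  have nn1 : 1 ≤ n := by omega
  have nr1 : (1 : ℝ) ≤ n := by exact_mod_cast nn1
  have lg0 : 0 ≤ Real.log n := Real.log_nonneg nr1
  have lg : Real.log n ≤ (2 * E + 2) * Real.log X := by
    have : n ≤ X ^ (2 * E + 2) := by
      calc n ≤ 12 * X * N ^ 2 := n2
        _ ≤ X * X * N ^ 2 := by gcongr
        _ = _ := by rw [hN]; ring
    have hr : (n : ℝ) ≤ (X : ℝ) ^ (2 * E + 2) := by exact_mod_cast this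
    have := Real.log_le_log (by linarith) hr
    rw [Real.log_pow] at this
    push_cast at this; exact this
  have d1 := dni_nonneg (n * β)
  have d2 := dni_nonneg (n * (a * β + b))
  calc (n : ℝ) * (Real.log n) ^ 2 * distNearestInt (n * (a * β + b)) * distNearestInt (n * β)
      = (Real.log n) ^ 2 * (n * distNearestInt (n * β)) * distNearestInt (n * (a * β + b)) := by ring
    _ ≤ ((2 * E + 2) * Real.log X) ^ 2 * (2 * v) * (2 / m) := by gcongr
    _ ≤ ((2 * E + 2) * Real.log X) ^ 2 * (2 * v) * (2 / (A * (Real.log X) ^ 2 * v)) := by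
        gcongr
    _ = 4 * (2 * E + 2) ^ 2 / A := by field_simp; norm_num
    _ < ε := by rw [div_lt_iff₀ (by linarith)]; linarith

lemma exists_X (A C δ : ℝ) (hδ : 0 < δ) (K : ℕ) : ∃ Y : ℕ, ∃ X : ℕ, X = Y ^ 2 ∧ 2 ≤ Real.log Y ∧
    2 * A * (Real.log X) ^ 2 ≤ X ∧ C ≤ X ∧ 1 ≤ δ * X ∧ K ≤ X ∧ 12 ≤ X := by
  have hsq : Filter.Tendsto (fun Y : ℕ => Y ^ 2) Filter.atTop Filter.atTop :=
    Filter.tendsto_pow_atTop (by norm_num)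
  have hsqr : Filter.Tendsto (fun Y : ℕ => ((Y ^ 2 : ℕ) : ℝ)) Filter.atTop Filter.atTop :=
    tendsto_natCast_atTop_atTop.comp hsq
  have e1 : ∀ᶠ Y : ℕ in Filter.atTop, 2 ≤ Real.log Y :=
    (Real.tendsto_log_atTop.comp tendsto_natCast_atTop_atTop).eventually_ge_atTop 2
  have e2 : ∀ᶠ Y : ℕ in Filter.atTop, 2 * A * (Real.log ((Y ^ 2 : ℕ) : ℝ)) ^ 2 ≤ ((Y ^ 2 : ℕ) : ℝ) := by
    have h := ((Real.isLittleO_pow_log_id_atTop (n := 2)).const_mul_left (2 * A)).bound one_pos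
    filter_upwards [hsqr.eventually h] with Y hY
    have hnn : (0 : ℝ) ≤ ((Y ^ 2 : ℕ) : ℝ) := Nat.cast_nonneg _
    rw [Real.norm_eq_abs, Real.norm_eq_abs, one_mul, id, abs_of_nonneg hnn] at hY
    exact (le_abs_self _).trans hY
  have e3 := hsqr.eventually_ge_atTop C
  have e4 := hsqr.eventually_ge_atTop (1 / δ)
  have e5 := hsq.eventually_ge_atTop K
  have e6 := hsq.eventually_ge_atTop 12
  obtain ⟨Y, h1, h2, h3, h4, h5, h6⟩ := (e1.and (e2.and (e3.and (e4.and (e5.and e6))))).exists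
  refine ⟨Y, Y ^ 2, rfl, h1, h2, h3, ?_, h5, h6⟩
  rw [div_le_iff₀ hδ] at h4
  linarith

set_option maxHeartbeats 1000000 in
theorem count (a b : ℝ) (hab : IsDiophantine a b) (ε : ℝ) (hε : 0 < ε) :
    ∃ c0 : ℝ, 0 < c0 ∧ ∀ c d : ℝ, c < d → d - c ≤ 1 → ∀ N0 : ℕ, ∃ N : ℕ, 1 ≤ N ∧
      ∃ G1 G2 : Finset M2, (∀ g ∈ G1, IsF c d N g) ∧ (∀ g ∈ G2, IsF 1 2 N g) ∧
      ∀ t : ℝ, 1 ≤ t → t ≤ 2 → ∀ P : Finset (M2 × M2),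
        (∀ γ ∈ G1 ×ˢ G2, γ.1.phi (γ.2.phi t) ∈ Bgood a b ε N0 → γ ∈ P) →
        c0 * (d - c) * (N : ℝ) ^ 4 ≤ P.card := by
  classical
  obtain ⟨E0, δ, hδ, hdich⟩ := dich a b hab
  set E : ℕ := 30 * (E0 + 1) + 1 with hE
  set A : ℝ := max 1 ((4 * (2 * (E : ℝ) + 2) ^ 2 + 1) / ε) with hAd
  have hA : 1 ≤ A := le_max_left _ _
  have hAε : 4 * (2 * (E : ℝ) + 2) ^ 2 < A * ε := by
    have : (4 * (2 * (E : ℝ) + 2) ^ 2 + 1) / ε ≤ A := le_max_right _ _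
    rw [div_le_iff₀ hε] at this
    linarith
  set c1 : ℝ := 1 / (64 * A) / (4 * (1 / (64 * A) + 2001)) with hc1
  have hc1p : 0 < c1 := by positivity
  refine ⟨c1 / 4096, by positivity, ?_⟩
  intro c d hcd hcd1 N0
  have hdc : 0 < d - c := by linarith
  obtain ⟨K1, hK1⟩ := farey c d hcd
  obtain ⟨K2, hK2⟩ := farey 1 2 (by norm_num)
  set B : ℕ := ⌈|c|⌉₊ + ⌈|d|⌉₊ + 1 with hB
  have hBc : |c| ≤ B := (Nat.le_ceil _).trans (by rw [hB]; push_cast; have := Nat.cast_nonneg (α := ℝ) ⌈|d|⌉₊; linarith)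
  have hBd : |d| ≤ B := (Nat.le_ceil _).trans (by rw [hB]; push_cast; have := Nat.cast_nonneg (α := ℝ) ⌈|c|⌉₊; linarith)
  set C : ℝ := 50000 * 4096 * 90000 * B / (d - c) with hC
  have hC0 : 0 ≤ C := by positivity
  obtain ⟨Y, X, hXY, hY, hX2, hXC, hXδ, hXK, hX12⟩ :=
    exists_X A (max (8 * |a|) (C * (128 * A))) δ hδ (K1 + K2 + 8 * N0)
  set N : ℕ := X ^ E with hN
  have hX1 : 1 ≤ X := by omega
  have hXN : X ≤ N := Nat.le_self_pow (by omega) _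
  have hXr : (12 : ℝ) ≤ X := by exact_mod_cast hX12
  have hNr : (1 : ℝ) ≤ N := by exact_mod_cast hX1.trans hXN
  obtain ⟨G1, hG1, hG1c⟩ := hK1 N (by omega)
  obtain ⟨G2, hG2, hG2c⟩ := hK2 N (by omega)
  refine ⟨N, hX1.trans hXN, G1, G2, hG1, hG2, ?_⟩
  intro t ht1 ht2 P hP
  have hlX : 1 ≤ Real.log X := by
    rw [hXY]; push_cast; rw [Real.log_pow]; push_cast; linarith
  have hcardΓ : (d - c) / 4096 * (N : ℝ) ^ 4 ≤ ((G1 ×ˢ G2).card : ℝ) := by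
    rw [Finset.card_product]; push_cast
    calc (d - c) / 4096 * (N : ℝ) ^ 4 = ((d - c) / 64 * (N : ℝ) ^ 2) * ((2 - 1) / 64 * (N : ℝ) ^ 2) := by ring
      _ ≤ _ := mul_le_mul hG1c hG2c (by positivity) (by positivity)
  set η : ℝ := 50000 * 4096 * B / ((d - c) * (X : ℝ) ^ 5) with hη
  have hη0 : 0 ≤ η := by positivity
  have hηC : η * (90000 * (X : ℝ) ^ 4) ≤ 1 / (128 * A) := by
    have e : η * (90000 * (X : ℝ) ^ 4) = C / X := by
      rw [hη, hC]; field_simp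
    rw [e, div_le_div_iff₀ (by linarith) (by positivity)]
    have := (le_max_right _ _).trans hXC
    linarith
  have hUc : ((Ut t X).card : ℝ) ≤ 3 * (X : ℝ) ^ 2 := by exact_mod_cast card_Ut t X
  have hzs := mw_sum A hA Y hY X hXY hX2 t ht1 ht2
  set z := ∑ u ∈ Ut t X, 1 / (mw A X t u : ℝ) with hz
  have hApos : 0 < 1 / (64 * A) := by positivity
  have hz0 : 0 < z := by linarith
  have hhalf : 1 / (128 * A) = 1 / (64 * A) / 2 := by field_simp; norm_num
  have main := second_moment (G1 ×ˢ G2) (fun γ => γ.2.p * Lf a b γ.1 + γ.2.q * Lf2 a b γ.1)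
    (fun γ => γ.2.r * Lf a b γ.1 + γ.2.s * Lf2 a b γ.1) (Ut t X) (mw A X t) η hη0 X (X ^ 5)
    (by
      intro u hu
      rw [mem_Ut] at hu
      exact ⟨hu.2.2.1, hu.1.1, hu.1.2, hu.2.1.1, hu.2.1.2⟩)
    (fun u hu => ⟨(mw_bounds A hA X hlX hX2 t u hu).1, (mw_bounds A hA X hlX hX2 t u hu).2.1⟩)
    (by
      calc 12 * X ^ 4 ≤ X * X ^ 4 := by gcongr
        _ = _ := by ring)
    (by
      intro f1 f2 hf1 hf2 hf
      have hQ : (X ^ 5) ^ 3 * (X ^ 5) ^ 3 = X ^ 30 := by ring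
      have := expsum a b E0 δ hδ hdich c d hcd.le hcd1 B (by omega) hBc hBd (X ^ 5) (X ^ 5) N
        (Nat.one_le_pow _ _ hX1) (by
          have : X ≤ X ^ 5 := Nat.le_self_pow (by norm_num) _
          omega)
        (by
          rw [hQ, hN]
          apply Nat.pow_le_pow_right hX1
          omega)
        (by
          rw [hQ, hN, hE]
          push_cast
          rw [pow_succ _ (30 * (E0 + 1)), pow_mul]
          have : (0 : ℝ) ≤ ((X : ℝ) ^ 30) ^ (E0 + 1) := by positivity
          nlinarith)
        G1 G2 hG1 hG2 f1 f2 hf1 hf2 hf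
      rw [Finset.sum_product_right]
      have e : ∀ g2 ∈ G2, ∀ g1 ∈ G1, ef (f1 * (g2.p * Lf a b g1 + g2.q * Lf2 a b g1)
            + f2 * (g2.r * Lf a b g1 + g2.s * Lf2 a b g1))
          = ef (u1 g2 f1 f2 * Lf a b g1 + u2 g2 f1 f2 * Lf2 a b g1) := by
        intro g2 _ g1 _
        congr 1
        simp only [u1, u2]; push_cast; ring
      rw [Finset.sum_congr rfl fun g2 h2 => Finset.sum_congr rfl fun g1 h1 => e g2 h2 g1 h1]
      refine this.trans ?_
      calc _ = η * ((d - c) / 4096 * (N : ℝ) ^ 4) := by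
            rw [hη]; push_cast; field_simp
        _ ≤ _ := by gcongr)
    z hz hz0
    (by
      have h1 : (1 : ℝ) ≤ (X : ℝ) ^ 2 := one_le_pow₀ (by linarith)
      calc η * (100 * (Ut t X).card) ≤ η * (90000 * (X : ℝ) ^ 4) := by
            apply mul_le_mul_of_nonneg_left _ hη0
            have h4 : (X : ℝ) ^ 2 ≤ (X : ℝ) ^ 4 := pow_le_pow_right₀ (by linarith) (by norm_num)
            linarith
        _ ≤ _ := hηC
        _ ≤ _ := by rw [hhalf]; linarith)
    (by
      calc η * (100 * (Ut t X).card) ^ 2 ≤ η * (100 * (3 * (X : ℝ) ^ 2)) ^ 2 := by gcongr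
        _ = η * (90000 * (X : ℝ) ^ 4) := by ring
        _ ≤ _ := hηC
        _ ≤ _ := by rw [hhalf]; linarith)
    P
    (by
      rintro γ hγ ⟨u, hu, hd⟩
      apply hP γ hγ
      rw [Finset.mem_product] at hγ
      refine good a b c d ε A hA E hAε X N N0 hX12 hN hlX hX2 ?_ (by omega) γ.1 γ.2 (hG1 _ hγ.1) (hG2 _ hγ.2) t
        ht1 ht2 u hu hd
      have h8 : 8 * |a| ≤ X := (le_max_left _ _).trans hXC
      calc 8 * |a| * (X : ℝ) ^ 4 ≤ X * (X : ℝ) ^ 4 := by gcongr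
        _ = (X : ℝ) ^ 5 := by ring
        _ ≤ (X : ℝ) ^ E := pow_le_pow_right₀ (by linarith) (by omega)
        _ = _ := by rw [hN]; push_cast; rfl)
  refine le_trans ?_ main
  have hmono : c1 ≤ z / (4 * (z + 2001)) := by
    rw [hc1, div_le_div_iff₀ (by positivity) (by positivity)]
    nlinarith
  calc c1 / 4096 * (d - c) * (N : ℝ) ^ 4 = ((d - c) / 4096 * (N : ℝ) ^ 4) * c1 := by ring
    _ ≤ _ := mul_le_mul hcardΓ hmono hc1p.le (by positivity)

lemma phi_measurable (g : M2) : Measurable g.phi := by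
  unfold M2.phi
  fun_prop

lemma IsF.phi_inj {c d : ℝ} {N : ℕ} {g : M2} (h : IsF c d N g) {t t' : ℝ} (ht : 0 < t) (ht' : 0 < t')
    (e : g.phi t = g.phi t') : t = t' := by
  have d1 := h.den_pos ht
  have d2 := h.den_pos ht'
  unfold M2.phi at e
  rw [div_eq_div_iff d1.ne' d2.ne'] at e
  have dr : (g.p : ℝ) * g.s - g.r * g.q = 1 := by exact_mod_cast h.det
  linear_combination e - (t - t') * dr

lemma IsF.phi_deriv {c d : ℝ} {N : ℕ} {g : M2} (h : IsF c d N g) {t : ℝ} (ht : 0 < t) :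
    HasDerivAt g.phi (1 / (g.q * t + g.s) ^ 2) t := by
  have d1 := h.den_pos ht
  have dr : (g.p : ℝ) * g.s - g.r * g.q = 1 := by exact_mod_cast h.det
  have h1 : HasDerivAt (fun t : ℝ => (g.p : ℝ) * t + g.r) g.p t := by
    simpa using ((hasDerivAt_id t).const_mul (g.p : ℝ)).add_const (g.r : ℝ)
  have h2 : HasDerivAt (fun t : ℝ => (g.q : ℝ) * t + g.s) g.q t := by
    simpa using ((hasDerivAt_id t).const_mul (g.q : ℝ)).add_const (g.s : ℝ)
  have e : (1 : ℝ) = g.p * (g.q * t + g.s) - (g.p * t + g.r) * g.q := by linear_combination -dr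
  rw [e]
  exact h1.div h2 d1.ne'

lemma IsF.image {c d : ℝ} {N : ℕ} {g : M2} (h : IsF c d N g) (hN : 1 ≤ N) (E : Set ℝ)
    (hE : MeasurableSet E) (hE12 : E ⊆ Set.Icc 1 2) :
    MeasurableSet (g.phi '' E) ∧
      ENNReal.ofReal (1 / (9 * (N : ℝ) ^ 2)) * volume E ≤ volume (g.phi '' E) := by
  have hpos : ∀ t ∈ E, 0 < t := fun t ht => by linarith [(hE12 ht).1]
  have hinj : Set.InjOn g.phi E := fun t ht t' ht' e => h.phi_inj (hpos t ht) (hpos t' ht') e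
  have hder : ∀ t ∈ E, HasDerivWithinAt g.phi (1 / (g.q * t + g.s) ^ 2) E t :=
    fun t ht => (h.phi_deriv (hpos t ht)).hasDerivWithinAt
  refine ⟨?_, ?_⟩
  · exact hE.image_of_continuousOn_injOn (fun t ht => (hder t ht).continuousWithinAt) hinj
  · have key := lintegral_image_eq_lintegral_abs_deriv_mul hE hder hinj (fun _ => 1)
    simp only [mul_one, lintegral_const, one_mul, Measure.restrict_apply MeasurableSet.univ,
      Set.univ_inter] at key
    rw [key, ← setLIntegral_const]
    apply setLIntegral_mono' hE
    intro t ht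
    apply ENNReal.ofReal_le_ofReal
    have d1 := h.den_pos (hpos t ht)
    rw [abs_of_nonneg (by positivity)]
    apply one_div_le_one_div_of_le (by positivity)
    have hq : (g.q : ℝ) ≤ N := by exact_mod_cast h.hqN
    have hs : (g.s : ℝ) ≤ N := by exact_mod_cast h.hsN
    have hq1 : (1 : ℝ) ≤ g.q := by exact_mod_cast h.q1
    have ht2 := (hE12 ht).2
    have : (g.q : ℝ) * t + g.s ≤ 3 * N := by nlinarith
    calc ((g.q : ℝ) * t + g.s) ^ 2 ≤ (3 * N) ^ 2 := pow_le_pow_left₀ d1.le this 2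
      _ = _ := by ring

lemma dni_measurable : Measurable distNearestInt := by
  unfold distNearestInt
  have : Measurable (fun x : ℝ => ((round x : ℤ) : ℝ)) := by
    simp only [round_eq]
    fun_prop
  fun_prop

lemma Bgood_measurable (a b ε : ℝ) (N0 : ℕ) : MeasurableSet (Bgood a b ε N0) := by
  have : Bgood a b ε N0 = ⋃ n : ℕ, ⋃ _ : N0 ≤ n, {β | (n : ℝ) * (Real.log n) ^ 2 *
      distNearestInt (n * (a * β + b)) * distNearestInt (n * β) < ε} := by
    ext β; simp [Bgood]
  rw [this]
  refine MeasurableSet.iUnion fun n => MeasurableSet.iUnion fun _ => ?_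
  have hm := dni_measurable
  exact measurableSet_lt (by fun_prop) measurable_const

theorem meas_lower (a b : ℝ) (hab : IsDiophantine a b) (ε : ℝ) (hε : 0 < ε) :
    ∃ c0 : ℝ, 0 < c0 ∧ ∀ c d : ℝ, c < d → d - c ≤ 1 → ∀ N0 : ℕ,
      ENNReal.ofReal (c0 * (d - c)) ≤ volume (Bgood a b ε N0 ∩ Set.Icc c d) := by
  classical
  obtain ⟨c0, hc0, hcount⟩ := count a b hab ε hε
  refine ⟨c0 / 81, by positivity, ?_⟩
  intro c d hcd hcd1 N0
  obtain ⟨N, hN, G1, G2, hG1, hG2, hP⟩ := hcount c d hcd hcd1 N0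
  have hNr : (1 : ℝ) ≤ N := by exact_mod_cast hN
  set W := Bgood a b ε N0 with hW
  have hWm : MeasurableSet W := Bgood_measurable a b ε N0
  set ph : M2 × M2 → ℝ → ℝ := fun γ t => γ.1.phi (γ.2.phi t) with hph
  have phm : ∀ γ, Measurable (ph γ) := fun γ => (phi_measurable γ.1).comp (phi_measurable γ.2)
  set Es : M2 × M2 → Set ℝ := fun γ => Set.Icc 1 2 ∩ (ph γ) ⁻¹' W with hEs
  have Esm : ∀ γ, MeasurableSet (Es γ) := fun γ => measurableSet_Icc.inter (phm γ hWm)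
  set Γ := G1 ×ˢ G2 with hΓ
  have im : ∀ γ ∈ Γ, MeasurableSet (ph γ '' Es γ) ∧
      ENNReal.ofReal (1 / (81 * (N : ℝ) ^ 4)) * volume (Es γ) ≤ volume (ph γ '' Es γ) := by
    intro γ hγ
    rw [hΓ, Finset.mem_product] at hγ
    have f1 := hG1 _ hγ.1
    have f2 := hG2 _ hγ.2
    obtain ⟨m1, v1⟩ := f2.image hN (Es γ) (Esm γ) Set.inter_subset_left
    have sub : γ.2.phi '' Es γ ⊆ Set.Icc 1 2 := by
      rintro _ ⟨t, ht, rfl⟩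
      exact f2.hphi t ht.1
    obtain ⟨m2, v2⟩ := f1.image hN _ m1 sub
    have e : ph γ '' Es γ = γ.1.phi '' (γ.2.phi '' Es γ) := by rw [Set.image_image]
    rw [e]
    refine ⟨m2, le_trans ?_ v2⟩
    calc _ = ENNReal.ofReal (1 / (9 * (N : ℝ) ^ 2)) * (ENNReal.ofReal (1 / (9 * (N : ℝ) ^ 2)) * volume (Es γ)) := by
          rw [← mul_assoc, ← ENNReal.ofReal_mul (by positivity)]
          congr 2
          field_simp; norm_num
      _ ≤ _ := by gcongr
  have disj : (Γ : Set (M2 × M2)).PairwiseDisjoint (fun γ => ph γ '' Es γ) := by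
    intro γ hγ γ' hγ' hne
    rw [Function.onFun, Set.disjoint_left]
    rintro _ ⟨t, ht, rfl⟩ ⟨t', ht', e⟩
    rw [hΓ, Finset.mem_coe, Finset.mem_product] at hγ hγ'
    have f1 := hG1 _ hγ.1
    have f2 := hG2 _ hγ.2
    have f1' := hG1 _ hγ'.1
    have f2' := hG2 _ hγ'.2
    have a1 := (f2.hphi t ht.1).1
    have a2 := (f2'.hphi t' ht'.1).1
    have b1 := ht.1.1
    have b2 := ht'.1.1
    simp only [hph] at e
    have e1 : γ'.1 = γ.1 := f1'.disj f1 (by linarith) (by linarith) e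
    rw [e1] at e
    have e2 := f1.phi_inj (by linarith) (by linarith) e
    have e3 : γ'.2 = γ.2 := f2'.disj f2 (by linarith) (by linarith) e2
    exact hne (Prod.ext e1.symm e3.symm)
  have subs : ⋃ γ ∈ Γ, ph γ '' Es γ ⊆ W ∩ Set.Icc c d := by
    intro β hβ
    simp only [Set.mem_iUnion] at hβ
    obtain ⟨γ, hγ, t, ht, rfl⟩ := hβ
    rw [hΓ, Finset.mem_product] at hγ
    exact ⟨ht.2, (hG1 _ hγ.1).hphi _ ((hG2 _ hγ.2).hphi _ ht.1)⟩
  have sumE : ENNReal.ofReal (c0 * (d - c) * (N : ℝ) ^ 4) ≤ ∑ γ ∈ Γ, volume (Es γ) := by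
    have e1 : ∀ γ ∈ Γ, volume (Es γ) = ∫⁻ t in Set.Icc (1 : ℝ) 2, ((ph γ) ⁻¹' W).indicator 1 t := by
      intro γ _
      rw [lintegral_indicator_one (phm γ hWm), Measure.restrict_apply (phm γ hWm), Set.inter_comm]
    rw [Finset.sum_congr rfl e1, ← lintegral_finsetSum]
    · calc _ = ∫⁻ t in Set.Icc (1 : ℝ) 2, ENNReal.ofReal (c0 * (d - c) * (N : ℝ) ^ 4) := by
            rw [setLIntegral_const, Real.volume_Icc]; norm_num
        _ ≤ _ := by
          apply setLIntegral_mono' measurableSet_Icc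
          intro t ht
          have := hP t ht.1 ht.2 (Γ.filter (fun γ => ph γ t ∈ W)) (by
            intro γ hγ hg
            rw [Finset.mem_filter]; exact ⟨hγ, hg⟩)
          have e2 : ∑ γ ∈ Γ, ((ph γ) ⁻¹' W).indicator (1 : ℝ → ENNReal) t
              = ((Γ.filter (fun γ => ph γ t ∈ W)).card : ENNReal) := by
            simp only [Set.indicator_apply, Set.mem_preimage, Pi.one_apply]
            rw [Finset.sum_boole]
          rw [e2, ← ENNReal.ofReal_natCast]
          exact ENNReal.ofReal_le_ofReal this
    · intro γ _
      exact measurable_one.indicator (phm γ hWm)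
  calc ENNReal.ofReal (c0 / 81 * (d - c))
      = ENNReal.ofReal (1 / (81 * (N : ℝ) ^ 4)) * ENNReal.ofReal (c0 * (d - c) * (N : ℝ) ^ 4) := by
        rw [← ENNReal.ofReal_mul (by positivity)]
        congr 1
        field_simp
    _ ≤ ENNReal.ofReal (1 / (81 * (N : ℝ) ^ 4)) * ∑ γ ∈ Γ, volume (Es γ) := by gcongr
    _ = ∑ γ ∈ Γ, ENNReal.ofReal (1 / (81 * (N : ℝ) ^ 4)) * volume (Es γ) := by rw [Finset.mul_sum]
    _ ≤ ∑ γ ∈ Γ, volume (ph γ '' Es γ) := Finset.sum_le_sum fun γ hγ => (im γ hγ).2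
    _ = volume (⋃ γ ∈ Γ, ph γ '' Es γ) := (measure_biUnion_finset disj fun γ hγ => (im γ hγ).1).symm
    _ ≤ _ := measure_mono subs

lemma ae_Bgood (a b : ℝ) (hab : IsDiophantine a b) (ε : ℝ) (hε : 0 < ε) (N0 : ℕ) :
    ∀ᵐ β ∂(volume : Measure ℝ), β ∈ Bgood a b ε N0 := by
  obtain ⟨c0, hc0, h⟩ := meas_lower a b hab ε hε
  have hd := Besicovitch.ae_tendsto_measure_inter_div_of_measurableSet (volume : Measure ℝ)
    (Bgood_measurable a b ε N0)
  filter_upwards [hd] with x hx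
  by_contra hn
  rw [Set.indicator_of_notMem hn] at hx
  have hlow : ∀ᶠ r in nhdsWithin (0 : ℝ) (Set.Ioi 0), ENNReal.ofReal c0 ≤
      volume (Bgood a b ε N0 ∩ Metric.closedBall x r) / volume (Metric.closedBall x r) := by
    have : Set.Ioo (0 : ℝ) (1 / 2) ∈ nhdsWithin (0 : ℝ) (Set.Ioi 0) := Ioo_mem_nhdsGT (by norm_num)
    filter_upwards [this] with r hr
    have hr0 := hr.1
    have hr1 := hr.2
    rw [Real.closedBall_eq_Icc, Real.volume_Icc]
    have hh := h (x - r) (x + r) (by linarith) (by linarith) N0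
    rw [ENNReal.le_div_iff_mul_le]
    · rw [← ENNReal.ofReal_mul hc0.le]; exact hh
    · left
      rw [ne_eq, ENNReal.ofReal_eq_zero]; linarith
    · left
      exact ENNReal.ofReal_ne_top
  have := ge_of_tendsto hx hlow
  rw [nonpos_iff_eq_zero, ENNReal.ofReal_eq_zero] at this
  linarith

theorem final_ae (a b : ℝ) (hab : IsDiophantine a b) :
    ∀ᵐ β ∂(volume : Measure ℝ), ∀ ε : ℝ, 0 < ε → ∀ N : ℕ, ∃ n : ℕ, N ≤ n ∧
      (n : ℝ) * (Real.log n) ^ 2 * distNearestInt (n * (a * β + b)) * distNearestInt (n * β) < ε := by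
  have : ∀ᵐ β ∂(volume : Measure ℝ), ∀ k N : ℕ, β ∈ Bgood a b (1 / ((k : ℝ) + 1)) N := by
    rw [ae_all_iff]; intro k
    rw [ae_all_iff]; intro N
    exact ae_Bgood a b hab _ (by positivity) N
  filter_upwards [this] with β hβ ε hε N
  obtain ⟨k, hk⟩ := exists_nat_one_div_lt hε
  obtain ⟨n, hn, hlt⟩ := hβ k N
  exact ⟨n, hn, hlt.trans hk⟩

/-- **Multiplicative approximation on Diophantine lines** (Chow–Yang, Theorem 1.4). -/
theorem gallagher_on_diophantine_lines (a b : ℝ) (hab : IsDiophantine a b) :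
    ∀ᵐ β ∂(volume : Measure ℝ),
      ∀ ε : ℝ, 0 < ε → ∀ N : ℕ, ∃ n : ℕ, N ≤ n ∧
        (n : ℝ) * (Real.log n) ^ 2 *
          distNearestInt (n * (a * β + b)) * distNearestInt (n * β) < ε := by
  exact final_ae a b hab

end
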